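/- A bialgebra admissible tuple (B₁, B₂, φ₁₂, φ₂₁) yields a Hopf datum by setting μ_l := (id ⊗ ε₂) ∘ φ₂₁, μ_r := (ε₁ ⊗ id) ∘ φ₂₁, ν_l := φ₁₂ ∘ (id ⊗ η₂), ν_r := φ₁₂ ∘ (η₁ ⊗ id); moreover the structure maps reconstructed from this Hopf datum satisfy φ₁₂ = (m₂ ⊗ m₁) ∘ (id ⊗ τ ⊗ id) ∘ (ν_l ⊗ ν_r) and φ₂₁ = (μ_l ⊗ μ_r) ∘ (id ⊗ τ ⊗ id) ∘ (Δ₂ ⊗ Δ₁). -/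

import Mathlib

open TensorProduct
open scoped TensorProduct

set_option maxHeartbeats 1000000
set_option linter.unusedVariables false

namespace CPB

section Combinators
variable {k : Type*} [CommRing k]
variable {A B C D R R' : Type*}
  [AddCommMonoid A] [Module k A] [AddCommMonoid B] [Module k B]
  [AddCommMonoid C] [Module k C] [AddCommMonoid D] [Module k D]
  [AddCommMonoid R] [Module k R] [AddCommMonoid R'] [Module k R']

/-- apply a map to the tail of a right-nested tensor product -/
noncomputable def skp (g : R →ₗ[k] R') : (A ⊗[k] R) →ₗ[k] (A ⊗[k] R') :=
  TensorProduct.map LinearMap.id g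

/-- apply a two-strand operation to the first two strands -/
noncomputable def pair2 (op : (A ⊗[k] B) →ₗ[k] (C ⊗[k] D)) :
    (A ⊗[k] (B ⊗[k] R)) →ₗ[k] (C ⊗[k] (D ⊗[k] R)) :=
  (TensorProduct.assoc k C D R).toLinearMap ∘ₗ
    TensorProduct.map op LinearMap.id ∘ₗ (TensorProduct.assoc k A B R).symm.toLinearMap

/-- multiply the first two strands together -/
noncomputable def merge2 (m : (A ⊗[k] B) →ₗ[k] C) :
    (A ⊗[k] (B ⊗[k] R)) →ₗ[k] (C ⊗[k] R) :=
  TensorProduct.map m LinearMap.id ∘ₗ (TensorProduct.assoc k A B R).symm.toLinearMap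

/-- split the first strand in two -/
noncomputable def split2 (d : A →ₗ[k] (C ⊗[k] D)) :
    (A ⊗[k] R) →ₗ[k] (C ⊗[k] (D ⊗[k] R)) :=
  (TensorProduct.assoc k C D R).toLinearMap ∘ₗ TensorProduct.map d LinearMap.id

/-- transpose the first two strands -/
noncomputable def swap2 : (A ⊗[k] (B ⊗[k] R)) →ₗ[k] (B ⊗[k] (A ⊗[k] R)) :=
  pair2 (TensorProduct.comm k A B).toLinearMap

/-- pair the two first strands off into a scalar -/
noncomputable def payL (p : (A ⊗[k] B) →ₗ[k] k) :
    (A ⊗[k] (B ⊗[k] R)) →ₗ[k] R :=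
  (TensorProduct.lid k R).toLinearMap ∘ₗ
    TensorProduct.map p LinearMap.id ∘ₗ (TensorProduct.assoc k A B R).symm.toLinearMap

end Combinators

section Apply4
variable {k : Type*} [CommRing k] {B1 B2 R : Type*}
  [AddCommMonoid B1] [Module k B1] [AddCommMonoid B2] [Module k B2]
  [AddCommMonoid R] [Module k R]

/-- apply an endomorphism of the four-fold tensor product to the first four strands -/
noncomputable def apply4
    (f : (B1 ⊗[k] (B2 ⊗[k] (B1 ⊗[k] B2))) →ₗ[k] (B1 ⊗[k] (B2 ⊗[k] (B1 ⊗[k] B2)))) :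
    (B1 ⊗[k] (B2 ⊗[k] (B1 ⊗[k] (B2 ⊗[k] R)))) →ₗ[k]
      (B1 ⊗[k] (B2 ⊗[k] (B1 ⊗[k] (B2 ⊗[k] R)))) :=
  letI E : ((B1 ⊗[k] (B2 ⊗[k] (B1 ⊗[k] B2))) ⊗[k] R) ≃ₗ[k]
      (B1 ⊗[k] (B2 ⊗[k] (B1 ⊗[k] (B2 ⊗[k] R)))) :=
    (TensorProduct.assoc k B1 (B2 ⊗[k] (B1 ⊗[k] B2)) R) ≪≫ₗ
      TensorProduct.congr (LinearEquiv.refl k B1)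
        ((TensorProduct.assoc k B2 (B1 ⊗[k] B2) R) ≪≫ₗ
          TensorProduct.congr (LinearEquiv.refl k B2) (TensorProduct.assoc k B1 B2 R))
  E.toLinearMap ∘ₗ TensorProduct.map f LinearMap.id ∘ₗ E.symm.toLinearMap

end Apply4

section Structures
variable (k : Type*) [CommRing k] (M : Type*) [AddCommMonoid M] [Module k M]

/-- `(M, mul, unit)` is an associative unital algebra (in terms of linear maps). -/
structure IsAlgMaps (mul : (M ⊗[k] M) →ₗ[k] M) (unit : k →ₗ[k] M) : Prop where
  mul_assoc :
    mul ∘ₗ TensorProduct.map mul LinearMap.id =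
      mul ∘ₗ TensorProduct.map LinearMap.id mul ∘ₗ (TensorProduct.assoc k M M M).toLinearMap
  one_mul :
    mul ∘ₗ TensorProduct.map unit LinearMap.id ∘ₗ (TensorProduct.lid k M).symm.toLinearMap =
      LinearMap.id
  mul_one :
    mul ∘ₗ TensorProduct.map LinearMap.id unit ∘ₗ (TensorProduct.rid k M).symm.toLinearMap =
      LinearMap.id

/-- `(M, comul, counit)` is a coassociative counital coalgebra (in terms of linear maps). -/
structure IsCoalgMaps (comul : M →ₗ[k] (M ⊗[k] M)) (counit : M →ₗ[k] k) : Prop where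
  coassoc :
    (TensorProduct.assoc k M M M).toLinearMap ∘ₗ TensorProduct.map comul LinearMap.id ∘ₗ comul =
      TensorProduct.map LinearMap.id comul ∘ₗ comul
  counit_left :
    (TensorProduct.lid k M).toLinearMap ∘ₗ TensorProduct.map counit LinearMap.id ∘ₗ comul =
      LinearMap.id
  counit_right :
    (TensorProduct.rid k M).toLinearMap ∘ₗ TensorProduct.map LinearMap.id counit ∘ₗ comul =
      LinearMap.id

/-- the given structure maps make `M` a bialgebra. -/
structure IsBialgebraMaps (mul : (M ⊗[k] M) →ₗ[k] M) (unit : k →ₗ[k] M)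
    (comul : M →ₗ[k] (M ⊗[k] M)) (counit : M →ₗ[k] k) : Prop where
  alg : IsAlgMaps k M mul unit
  coalg : IsCoalgMaps k M comul counit
  comul_mul :
    comul ∘ₗ mul =
      TensorProduct.map mul mul ∘ₗ (TensorProduct.tensorTensorTensorComm k M M M M).toLinearMap ∘ₗ
        TensorProduct.map comul comul
  counit_mul :
    counit ∘ₗ mul = LinearMap.mul' k k ∘ₗ TensorProduct.map counit counit
  comul_unit :
    comul ∘ₗ unit = TensorProduct.map unit unit ∘ₗ (TensorProduct.lid k k).symm.toLinearMap
  counit_unit : counit ∘ₗ unit = LinearMap.id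

/-- an object which is simultaneously an algebra and a coalgebra. -/
structure ACData where
  mul : (M ⊗[k] M) →ₗ[k] M
  unit : k →ₗ[k] M
  comul : M →ₗ[k] (M ⊗[k] M)
  counit : M →ₗ[k] k
  alg : IsAlgMaps k M mul unit
  coalg : IsCoalgMaps k M comul counit

end Structures

section Cross
variable {k : Type*} [CommRing k] {B1 B2 : Type*}
  [AddCommMonoid B1] [Module k B1] [AddCommMonoid B2] [Module k B2]

/-- the multiplication `(m₁ ⊗ m₂) ∘ (id ⊗ φ₂₁ ⊗ id)` of a would-be cross product bialgebra -/
noncomputable def crossMul (m1 : (B1 ⊗[k] B1) →ₗ[k] B1) (m2 : (B2 ⊗[k] B2) →ₗ[k] B2)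
    (phi21 : (B2 ⊗[k] B1) →ₗ[k] (B1 ⊗[k] B2)) :
    ((B1 ⊗[k] B2) ⊗[k] (B1 ⊗[k] B2)) →ₗ[k] (B1 ⊗[k] B2) :=
  ((skp m2) : (B1 ⊗[k] (B2 ⊗[k] B2)) →ₗ[k] (B1 ⊗[k] B2))
    ∘ₗ ((merge2 m1) : (B1 ⊗[k] (B1 ⊗[k] (B2 ⊗[k] B2))) →ₗ[k] (B1 ⊗[k] (B2 ⊗[k] B2)))
    ∘ₗ ((skp (pair2 phi21)) : (B1 ⊗[k] (B2 ⊗[k] (B1 ⊗[k] B2))) →ₗ[k]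
        (B1 ⊗[k] (B1 ⊗[k] (B2 ⊗[k] B2))))
    ∘ₗ (TensorProduct.assoc k B1 B2 (B1 ⊗[k] B2)).toLinearMap

/-- the unit `η₁ ⊗ η₂` of a would-be cross product bialgebra -/
noncomputable def crossUnit (eta1 : k →ₗ[k] B1) (eta2 : k →ₗ[k] B2) :
    k →ₗ[k] (B1 ⊗[k] B2) :=
  TensorProduct.map eta1 eta2 ∘ₗ (TensorProduct.lid k k).symm.toLinearMap

/-- the comultiplication `(id ⊗ φ₁₂ ⊗ id) ∘ (Δ₁ ⊗ Δ₂)` of a would-be cross product bialgebra -/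
noncomputable def crossComul (delta1 : B1 →ₗ[k] (B1 ⊗[k] B1)) (delta2 : B2 →ₗ[k] (B2 ⊗[k] B2))
    (phi12 : (B1 ⊗[k] B2) →ₗ[k] (B2 ⊗[k] B1)) :
    (B1 ⊗[k] B2) →ₗ[k] ((B1 ⊗[k] B2) ⊗[k] (B1 ⊗[k] B2)) :=
  (TensorProduct.assoc k B1 B2 (B1 ⊗[k] B2)).symm.toLinearMap
    ∘ₗ ((skp (pair2 phi12)) : (B1 ⊗[k] (B1 ⊗[k] (B2 ⊗[k] B2))) →ₗ[k]
        (B1 ⊗[k] (B2 ⊗[k] (B1 ⊗[k] B2))))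
    ∘ₗ ((skp (skp delta2)) : (B1 ⊗[k] (B1 ⊗[k] B2)) →ₗ[k] (B1 ⊗[k] (B1 ⊗[k] (B2 ⊗[k] B2))))
    ∘ₗ ((split2 delta1) : (B1 ⊗[k] B2) →ₗ[k] (B1 ⊗[k] (B1 ⊗[k] B2)))

/-- the counit `ε₁ ⊗ ε₂` of a would-be cross product bialgebra -/
noncomputable def crossCounit (eps1 : B1 →ₗ[k] k) (eps2 : B2 →ₗ[k] k) :
    (B1 ⊗[k] B2) →ₗ[k] k :=
  LinearMap.mul' k k ∘ₗ TensorProduct.map eps1 eps2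

end Cross


section HopfDatumSection
variable (k : Type*) [CommRing k] (B1 B2 : Type*)
  [AddCommMonoid B1] [Module k B1] [AddCommMonoid B2] [Module k B2]

noncomputable def ax_actL_act (m1 : (B1 ⊗[k] B1) →ₗ[k] B1) (eta1 : k →ₗ[k] B1)
    (delta1 : B1 →ₗ[k] (B1 ⊗[k] B1)) (eps1 : B1 →ₗ[k] k)
    (m2 : (B2 ⊗[k] B2) →ₗ[k] B2) (eta2 : k →ₗ[k] B2)
    (delta2 : B2 →ₗ[k] (B2 ⊗[k] B2)) (eps2 : B2 →ₗ[k] k)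
    (actL : (B2 ⊗[k] B1) →ₗ[k] B1) (coactL : B1 →ₗ[k] (B2 ⊗[k] B1))
    (actR : (B2 ⊗[k] B1) →ₗ[k] B2) (coactR : B2 →ₗ[k] (B2 ⊗[k] B1)) : Prop :=
    actL ∘ₗ ((merge2 m2) : (B2 ⊗[k] (B2 ⊗[k] B1)) →ₗ[k] (B2 ⊗[k] B1)) =
      actL ∘ₗ ((skp actL) : (B2 ⊗[k] (B2 ⊗[k] B1)) →ₗ[k] (B2 ⊗[k] B1))

noncomputable def ax_actL_unit (m1 : (B1 ⊗[k] B1) →ₗ[k] B1) (eta1 : k →ₗ[k] B1)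
    (delta1 : B1 →ₗ[k] (B1 ⊗[k] B1)) (eps1 : B1 →ₗ[k] k)
    (m2 : (B2 ⊗[k] B2) →ₗ[k] B2) (eta2 : k →ₗ[k] B2)
    (delta2 : B2 →ₗ[k] (B2 ⊗[k] B2)) (eps2 : B2 →ₗ[k] k)
    (actL : (B2 ⊗[k] B1) →ₗ[k] B1) (coactL : B1 →ₗ[k] (B2 ⊗[k] B1))
    (actR : (B2 ⊗[k] B1) →ₗ[k] B2) (coactR : B2 →ₗ[k] (B2 ⊗[k] B1)) : Prop :=
    actL ∘ₗ TensorProduct.map eta2 LinearMap.id ∘ₗ (TensorProduct.lid k B1).symm.toLinearMap =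
      LinearMap.id

noncomputable def ax_actR_act (m1 : (B1 ⊗[k] B1) →ₗ[k] B1) (eta1 : k →ₗ[k] B1)
    (delta1 : B1 →ₗ[k] (B1 ⊗[k] B1)) (eps1 : B1 →ₗ[k] k)
    (m2 : (B2 ⊗[k] B2) →ₗ[k] B2) (eta2 : k →ₗ[k] B2)
    (delta2 : B2 →ₗ[k] (B2 ⊗[k] B2)) (eps2 : B2 →ₗ[k] k)
    (actL : (B2 ⊗[k] B1) →ₗ[k] B1) (coactL : B1 →ₗ[k] (B2 ⊗[k] B1))
    (actR : (B2 ⊗[k] B1) →ₗ[k] B2) (coactR : B2 →ₗ[k] (B2 ⊗[k] B1)) : Prop :=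
    actR ∘ₗ ((skp m1) : (B2 ⊗[k] (B1 ⊗[k] B1)) →ₗ[k] (B2 ⊗[k] B1)) =
      actR ∘ₗ ((merge2 actR) : (B2 ⊗[k] (B1 ⊗[k] B1)) →ₗ[k] (B2 ⊗[k] B1))

noncomputable def ax_actR_unit (m1 : (B1 ⊗[k] B1) →ₗ[k] B1) (eta1 : k →ₗ[k] B1)
    (delta1 : B1 →ₗ[k] (B1 ⊗[k] B1)) (eps1 : B1 →ₗ[k] k)
    (m2 : (B2 ⊗[k] B2) →ₗ[k] B2) (eta2 : k →ₗ[k] B2)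
    (delta2 : B2 →ₗ[k] (B2 ⊗[k] B2)) (eps2 : B2 →ₗ[k] k)
    (actL : (B2 ⊗[k] B1) →ₗ[k] B1) (coactL : B1 →ₗ[k] (B2 ⊗[k] B1))
    (actR : (B2 ⊗[k] B1) →ₗ[k] B2) (coactR : B2 →ₗ[k] (B2 ⊗[k] B1)) : Prop :=
    actR ∘ₗ TensorProduct.map LinearMap.id eta1 ∘ₗ (TensorProduct.rid k B2).symm.toLinearMap =
      LinearMap.id

noncomputable def ax_coactL_coact (m1 : (B1 ⊗[k] B1) →ₗ[k] B1) (eta1 : k →ₗ[k] B1)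
    (delta1 : B1 →ₗ[k] (B1 ⊗[k] B1)) (eps1 : B1 →ₗ[k] k)
    (m2 : (B2 ⊗[k] B2) →ₗ[k] B2) (eta2 : k →ₗ[k] B2)
    (delta2 : B2 →ₗ[k] (B2 ⊗[k] B2)) (eps2 : B2 →ₗ[k] k)
    (actL : (B2 ⊗[k] B1) →ₗ[k] B1) (coactL : B1 →ₗ[k] (B2 ⊗[k] B1))
    (actR : (B2 ⊗[k] B1) →ₗ[k] B2) (coactR : B2 →ₗ[k] (B2 ⊗[k] B1)) : Prop :=
    ((split2 delta2) : (B2 ⊗[k] B1) →ₗ[k] (B2 ⊗[k] (B2 ⊗[k] B1))) ∘ₗ coactL =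
      ((skp coactL) : (B2 ⊗[k] B1) →ₗ[k] (B2 ⊗[k] (B2 ⊗[k] B1))) ∘ₗ coactL

noncomputable def ax_coactL_counit (m1 : (B1 ⊗[k] B1) →ₗ[k] B1) (eta1 : k →ₗ[k] B1)
    (delta1 : B1 →ₗ[k] (B1 ⊗[k] B1)) (eps1 : B1 →ₗ[k] k)
    (m2 : (B2 ⊗[k] B2) →ₗ[k] B2) (eta2 : k →ₗ[k] B2)
    (delta2 : B2 →ₗ[k] (B2 ⊗[k] B2)) (eps2 : B2 →ₗ[k] k)
    (actL : (B2 ⊗[k] B1) →ₗ[k] B1) (coactL : B1 →ₗ[k] (B2 ⊗[k] B1))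
    (actR : (B2 ⊗[k] B1) →ₗ[k] B2) (coactR : B2 →ₗ[k] (B2 ⊗[k] B1)) : Prop :=
    (TensorProduct.lid k B1).toLinearMap ∘ₗ TensorProduct.map eps2 LinearMap.id ∘ₗ coactL =
      LinearMap.id

noncomputable def ax_coactR_coact (m1 : (B1 ⊗[k] B1) →ₗ[k] B1) (eta1 : k →ₗ[k] B1)
    (delta1 : B1 →ₗ[k] (B1 ⊗[k] B1)) (eps1 : B1 →ₗ[k] k)
    (m2 : (B2 ⊗[k] B2) →ₗ[k] B2) (eta2 : k →ₗ[k] B2)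
    (delta2 : B2 →ₗ[k] (B2 ⊗[k] B2)) (eps2 : B2 →ₗ[k] k)
    (actL : (B2 ⊗[k] B1) →ₗ[k] B1) (coactL : B1 →ₗ[k] (B2 ⊗[k] B1))
    (actR : (B2 ⊗[k] B1) →ₗ[k] B2) (coactR : B2 →ₗ[k] (B2 ⊗[k] B1)) : Prop :=
    ((split2 coactR) : (B2 ⊗[k] B1) →ₗ[k] (B2 ⊗[k] (B1 ⊗[k] B1))) ∘ₗ coactR =
      ((skp delta1) : (B2 ⊗[k] B1) →ₗ[k] (B2 ⊗[k] (B1 ⊗[k] B1))) ∘ₗ coactR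

noncomputable def ax_coactR_counit (m1 : (B1 ⊗[k] B1) →ₗ[k] B1) (eta1 : k →ₗ[k] B1)
    (delta1 : B1 →ₗ[k] (B1 ⊗[k] B1)) (eps1 : B1 →ₗ[k] k)
    (m2 : (B2 ⊗[k] B2) →ₗ[k] B2) (eta2 : k →ₗ[k] B2)
    (delta2 : B2 →ₗ[k] (B2 ⊗[k] B2)) (eps2 : B2 →ₗ[k] k)
    (actL : (B2 ⊗[k] B1) →ₗ[k] B1) (coactL : B1 →ₗ[k] (B2 ⊗[k] B1))
    (actR : (B2 ⊗[k] B1) →ₗ[k] B2) (coactR : B2 →ₗ[k] (B2 ⊗[k] B1)) : Prop :=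
    (TensorProduct.rid k B2).toLinearMap ∘ₗ TensorProduct.map LinearMap.id eps1 ∘ₗ coactR =
      LinearMap.id

noncomputable def ax_actR_eta2 (m1 : (B1 ⊗[k] B1) →ₗ[k] B1) (eta1 : k →ₗ[k] B1)
    (delta1 : B1 →ₗ[k] (B1 ⊗[k] B1)) (eps1 : B1 →ₗ[k] k)
    (m2 : (B2 ⊗[k] B2) →ₗ[k] B2) (eta2 : k →ₗ[k] B2)
    (delta2 : B2 →ₗ[k] (B2 ⊗[k] B2)) (eps2 : B2 →ₗ[k] k)
    (actL : (B2 ⊗[k] B1) →ₗ[k] B1) (coactL : B1 →ₗ[k] (B2 ⊗[k] B1))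
    (actR : (B2 ⊗[k] B1) →ₗ[k] B2) (coactR : B2 →ₗ[k] (B2 ⊗[k] B1)) : Prop :=
    actR ∘ₗ TensorProduct.map eta2 LinearMap.id ∘ₗ (TensorProduct.lid k B1).symm.toLinearMap =
      eta2 ∘ₗ eps1

noncomputable def ax_coactL_eps1 (m1 : (B1 ⊗[k] B1) →ₗ[k] B1) (eta1 : k →ₗ[k] B1)
    (delta1 : B1 →ₗ[k] (B1 ⊗[k] B1)) (eps1 : B1 →ₗ[k] k)
    (m2 : (B2 ⊗[k] B2) →ₗ[k] B2) (eta2 : k →ₗ[k] B2)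
    (delta2 : B2 →ₗ[k] (B2 ⊗[k] B2)) (eps2 : B2 →ₗ[k] k)
    (actL : (B2 ⊗[k] B1) →ₗ[k] B1) (coactL : B1 →ₗ[k] (B2 ⊗[k] B1))
    (actR : (B2 ⊗[k] B1) →ₗ[k] B2) (coactR : B2 →ₗ[k] (B2 ⊗[k] B1)) : Prop :=
    (TensorProduct.rid k B2).toLinearMap ∘ₗ TensorProduct.map LinearMap.id eps1 ∘ₗ coactL =
      eta2 ∘ₗ eps1

noncomputable def ax_eps2_actR (m1 : (B1 ⊗[k] B1) →ₗ[k] B1) (eta1 : k →ₗ[k] B1)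
    (delta1 : B1 →ₗ[k] (B1 ⊗[k] B1)) (eps1 : B1 →ₗ[k] k)
    (m2 : (B2 ⊗[k] B2) →ₗ[k] B2) (eta2 : k →ₗ[k] B2)
    (delta2 : B2 →ₗ[k] (B2 ⊗[k] B2)) (eps2 : B2 →ₗ[k] k)
    (actL : (B2 ⊗[k] B1) →ₗ[k] B1) (coactL : B1 →ₗ[k] (B2 ⊗[k] B1))
    (actR : (B2 ⊗[k] B1) →ₗ[k] B2) (coactR : B2 →ₗ[k] (B2 ⊗[k] B1)) : Prop :=
    eps2 ∘ₗ actR = LinearMap.mul' k k ∘ₗ TensorProduct.map eps2 eps1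

noncomputable def ax_eps1_actL (m1 : (B1 ⊗[k] B1) →ₗ[k] B1) (eta1 : k →ₗ[k] B1)
    (delta1 : B1 →ₗ[k] (B1 ⊗[k] B1)) (eps1 : B1 →ₗ[k] k)
    (m2 : (B2 ⊗[k] B2) →ₗ[k] B2) (eta2 : k →ₗ[k] B2)
    (delta2 : B2 →ₗ[k] (B2 ⊗[k] B2)) (eps2 : B2 →ₗ[k] k)
    (actL : (B2 ⊗[k] B1) →ₗ[k] B1) (coactL : B1 →ₗ[k] (B2 ⊗[k] B1))
    (actR : (B2 ⊗[k] B1) →ₗ[k] B2) (coactR : B2 →ₗ[k] (B2 ⊗[k] B1)) : Prop :=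
    eps1 ∘ₗ actL = LinearMap.mul' k k ∘ₗ TensorProduct.map eps2 eps1

noncomputable def ax_actL_eta1 (m1 : (B1 ⊗[k] B1) →ₗ[k] B1) (eta1 : k →ₗ[k] B1)
    (delta1 : B1 →ₗ[k] (B1 ⊗[k] B1)) (eps1 : B1 →ₗ[k] k)
    (m2 : (B2 ⊗[k] B2) →ₗ[k] B2) (eta2 : k →ₗ[k] B2)
    (delta2 : B2 →ₗ[k] (B2 ⊗[k] B2)) (eps2 : B2 →ₗ[k] k)
    (actL : (B2 ⊗[k] B1) →ₗ[k] B1) (coactL : B1 →ₗ[k] (B2 ⊗[k] B1))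
    (actR : (B2 ⊗[k] B1) →ₗ[k] B2) (coactR : B2 →ₗ[k] (B2 ⊗[k] B1)) : Prop :=
    actL ∘ₗ TensorProduct.map LinearMap.id eta1 ∘ₗ (TensorProduct.rid k B2).symm.toLinearMap =
      eta1 ∘ₗ eps2

noncomputable def ax_coactR_eps2 (m1 : (B1 ⊗[k] B1) →ₗ[k] B1) (eta1 : k →ₗ[k] B1)
    (delta1 : B1 →ₗ[k] (B1 ⊗[k] B1)) (eps1 : B1 →ₗ[k] k)
    (m2 : (B2 ⊗[k] B2) →ₗ[k] B2) (eta2 : k →ₗ[k] B2)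
    (delta2 : B2 →ₗ[k] (B2 ⊗[k] B2)) (eps2 : B2 →ₗ[k] k)
    (actL : (B2 ⊗[k] B1) →ₗ[k] B1) (coactL : B1 →ₗ[k] (B2 ⊗[k] B1))
    (actR : (B2 ⊗[k] B1) →ₗ[k] B2) (coactR : B2 →ₗ[k] (B2 ⊗[k] B1)) : Prop :=
    (TensorProduct.lid k B1).toLinearMap ∘ₗ TensorProduct.map eps2 LinearMap.id ∘ₗ coactR =
      eta1 ∘ₗ eps2

noncomputable def ax_coactR_eta2 (m1 : (B1 ⊗[k] B1) →ₗ[k] B1) (eta1 : k →ₗ[k] B1)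
    (delta1 : B1 →ₗ[k] (B1 ⊗[k] B1)) (eps1 : B1 →ₗ[k] k)
    (m2 : (B2 ⊗[k] B2) →ₗ[k] B2) (eta2 : k →ₗ[k] B2)
    (delta2 : B2 →ₗ[k] (B2 ⊗[k] B2)) (eps2 : B2 →ₗ[k] k)
    (actL : (B2 ⊗[k] B1) →ₗ[k] B1) (coactL : B1 →ₗ[k] (B2 ⊗[k] B1))
    (actR : (B2 ⊗[k] B1) →ₗ[k] B2) (coactR : B2 →ₗ[k] (B2 ⊗[k] B1)) : Prop :=
    coactR ∘ₗ eta2 = TensorProduct.map eta2 eta1 ∘ₗ (TensorProduct.lid k k).symm.toLinearMap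

noncomputable def ax_coactL_eta1 (m1 : (B1 ⊗[k] B1) →ₗ[k] B1) (eta1 : k →ₗ[k] B1)
    (delta1 : B1 →ₗ[k] (B1 ⊗[k] B1)) (eps1 : B1 →ₗ[k] k)
    (m2 : (B2 ⊗[k] B2) →ₗ[k] B2) (eta2 : k →ₗ[k] B2)
    (delta2 : B2 →ₗ[k] (B2 ⊗[k] B2)) (eps2 : B2 →ₗ[k] k)
    (actL : (B2 ⊗[k] B1) →ₗ[k] B1) (coactL : B1 →ₗ[k] (B2 ⊗[k] B1))
    (actR : (B2 ⊗[k] B1) →ₗ[k] B2) (coactR : B2 →ₗ[k] (B2 ⊗[k] B1)) : Prop :=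
    coactL ∘ₗ eta1 = TensorProduct.map eta2 eta1 ∘ₗ (TensorProduct.lid k k).symm.toLinearMap

noncomputable def ax_algCoalg1 (m1 : (B1 ⊗[k] B1) →ₗ[k] B1) (eta1 : k →ₗ[k] B1)
    (delta1 : B1 →ₗ[k] (B1 ⊗[k] B1)) (eps1 : B1 →ₗ[k] k)
    (m2 : (B2 ⊗[k] B2) →ₗ[k] B2) (eta2 : k →ₗ[k] B2)
    (delta2 : B2 →ₗ[k] (B2 ⊗[k] B2)) (eps2 : B2 →ₗ[k] k)
    (actL : (B2 ⊗[k] B1) →ₗ[k] B1) (coactL : B1 →ₗ[k] (B2 ⊗[k] B1))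
    (actR : (B2 ⊗[k] B1) →ₗ[k] B2) (coactR : B2 →ₗ[k] (B2 ⊗[k] B1)) : Prop :=
    (delta1 : B1 →ₗ[k] (B1 ⊗[k] B1))
      ∘ₗ (m1 : (B1 ⊗[k] B1) →ₗ[k] B1)
    =
    ((skp m1) : (B1 ⊗[k] (B1 ⊗[k] B1)) →ₗ[k] (B1 ⊗[k] B1))
      ∘ₗ ((merge2 m1) : (B1 ⊗[k] (B1 ⊗[k] (B1 ⊗[k] B1))) →ₗ[k] (B1 ⊗[k] (B1 ⊗[k] B1)))
      ∘ₗ ((skp (merge2 actL)) : (B1 ⊗[k] (B2 ⊗[k] (B1 ⊗[k] (B1 ⊗[k] B1)))) →ₗ[k] (B1 ⊗[k] (B1 ⊗[k] (B1 ⊗[k] B1))))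
      ∘ₗ ((skp (skp swap2)) : (B1 ⊗[k] (B2 ⊗[k] (B1 ⊗[k] (B1 ⊗[k] B1)))) →ₗ[k] (B1 ⊗[k] (B2 ⊗[k] (B1 ⊗[k] (B1 ⊗[k] B1)))))
      ∘ₗ ((skp (split2 coactL)) : (B1 ⊗[k] (B1 ⊗[k] (B1 ⊗[k] B1))) →ₗ[k] (B1 ⊗[k] (B2 ⊗[k] (B1 ⊗[k] (B1 ⊗[k] B1)))))
      ∘ₗ ((skp (skp delta1)) : (B1 ⊗[k] (B1 ⊗[k] B1)) →ₗ[k] (B1 ⊗[k] (B1 ⊗[k] (B1 ⊗[k] B1))))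
      ∘ₗ ((split2 delta1) : (B1 ⊗[k] B1) →ₗ[k] (B1 ⊗[k] (B1 ⊗[k] B1)))

noncomputable def ax_algCoalg2 (m1 : (B1 ⊗[k] B1) →ₗ[k] B1) (eta1 : k →ₗ[k] B1)
    (delta1 : B1 →ₗ[k] (B1 ⊗[k] B1)) (eps1 : B1 →ₗ[k] k)
    (m2 : (B2 ⊗[k] B2) →ₗ[k] B2) (eta2 : k →ₗ[k] B2)
    (delta2 : B2 →ₗ[k] (B2 ⊗[k] B2)) (eps2 : B2 →ₗ[k] k)
    (actL : (B2 ⊗[k] B1) →ₗ[k] B1) (coactL : B1 →ₗ[k] (B2 ⊗[k] B1))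
    (actR : (B2 ⊗[k] B1) →ₗ[k] B2) (coactR : B2 →ₗ[k] (B2 ⊗[k] B1)) : Prop :=
    (delta2 : B2 →ₗ[k] (B2 ⊗[k] B2))
      ∘ₗ (m2 : (B2 ⊗[k] B2) →ₗ[k] B2)
    =
    ((skp m2) : (B2 ⊗[k] (B2 ⊗[k] B2)) →ₗ[k] (B2 ⊗[k] B2))
      ∘ₗ ((merge2 m2) : (B2 ⊗[k] (B2 ⊗[k] (B2 ⊗[k] B2))) →ₗ[k] (B2 ⊗[k] (B2 ⊗[k] B2)))
      ∘ₗ ((skp (skp (merge2 actR))) : (B2 ⊗[k] (B2 ⊗[k] (B2 ⊗[k] (B1 ⊗[k] B2)))) →ₗ[k] (B2 ⊗[k] (B2 ⊗[k] (B2 ⊗[k] B2))))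
      ∘ₗ ((skp swap2) : (B2 ⊗[k] (B2 ⊗[k] (B2 ⊗[k] (B1 ⊗[k] B2)))) →ₗ[k] (B2 ⊗[k] (B2 ⊗[k] (B2 ⊗[k] (B1 ⊗[k] B2)))))
      ∘ₗ ((skp (skp (split2 coactR))) : (B2 ⊗[k] (B2 ⊗[k] (B2 ⊗[k] B2))) →ₗ[k] (B2 ⊗[k] (B2 ⊗[k] (B2 ⊗[k] (B1 ⊗[k] B2)))))
      ∘ₗ ((skp (skp delta2)) : (B2 ⊗[k] (B2 ⊗[k] B2)) →ₗ[k] (B2 ⊗[k] (B2 ⊗[k] (B2 ⊗[k] B2))))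
      ∘ₗ ((split2 delta2) : (B2 ⊗[k] B2) →ₗ[k] (B2 ⊗[k] (B2 ⊗[k] B2)))

noncomputable def ax_modComod (m1 : (B1 ⊗[k] B1) →ₗ[k] B1) (eta1 : k →ₗ[k] B1)
    (delta1 : B1 →ₗ[k] (B1 ⊗[k] B1)) (eps1 : B1 →ₗ[k] k)
    (m2 : (B2 ⊗[k] B2) →ₗ[k] B2) (eta2 : k →ₗ[k] B2)
    (delta2 : B2 →ₗ[k] (B2 ⊗[k] B2)) (eps2 : B2 →ₗ[k] k)
    (actL : (B2 ⊗[k] B1) →ₗ[k] B1) (coactL : B1 →ₗ[k] (B2 ⊗[k] B1))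
    (actR : (B2 ⊗[k] B1) →ₗ[k] B2) (coactR : B2 →ₗ[k] (B2 ⊗[k] B1)) : Prop :=
    ((skp m1) : (B2 ⊗[k] (B1 ⊗[k] B1)) →ₗ[k] (B2 ⊗[k] B1))
      ∘ₗ ((merge2 m2) : (B2 ⊗[k] (B2 ⊗[k] (B1 ⊗[k] B1))) →ₗ[k] (B2 ⊗[k] (B1 ⊗[k] B1)))
      ∘ₗ ((skp swap2) : (B2 ⊗[k] (B1 ⊗[k] (B2 ⊗[k] B1))) →ₗ[k] (B2 ⊗[k] (B2 ⊗[k] (B1 ⊗[k] B1))))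
      ∘ₗ ((skp (skp coactR)) : (B2 ⊗[k] (B1 ⊗[k] B2)) →ₗ[k] (B2 ⊗[k] (B1 ⊗[k] (B2 ⊗[k] B1))))
      ∘ₗ ((split2 coactL) : (B1 ⊗[k] B2) →ₗ[k] (B2 ⊗[k] (B1 ⊗[k] B2)))
      ∘ₗ ((skp actR) : (B1 ⊗[k] (B2 ⊗[k] B1)) →ₗ[k] (B1 ⊗[k] B2))
      ∘ₗ ((merge2 actL) : (B2 ⊗[k] (B1 ⊗[k] (B2 ⊗[k] B1))) →ₗ[k] (B1 ⊗[k] (B2 ⊗[k] B1)))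
      ∘ₗ ((skp swap2) : (B2 ⊗[k] (B2 ⊗[k] (B1 ⊗[k] B1))) →ₗ[k] (B2 ⊗[k] (B1 ⊗[k] (B2 ⊗[k] B1))))
      ∘ₗ ((skp (skp delta1)) : (B2 ⊗[k] (B2 ⊗[k] B1)) →ₗ[k] (B2 ⊗[k] (B2 ⊗[k] (B1 ⊗[k] B1))))
      ∘ₗ ((split2 delta2) : (B2 ⊗[k] B1) →ₗ[k] (B2 ⊗[k] (B2 ⊗[k] B1)))
    =
    ((skp m1) : (B2 ⊗[k] (B1 ⊗[k] B1)) →ₗ[k] (B2 ⊗[k] B1))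
      ∘ₗ ((merge2 m2) : (B2 ⊗[k] (B2 ⊗[k] (B1 ⊗[k] B1))) →ₗ[k] (B2 ⊗[k] (B1 ⊗[k] B1)))
      ∘ₗ ((skp (skp (skp actL))) : (B2 ⊗[k] (B2 ⊗[k] (B1 ⊗[k] (B2 ⊗[k] B1)))) →ₗ[k] (B2 ⊗[k] (B2 ⊗[k] (B1 ⊗[k] B1))))
      ∘ₗ ((skp swap2) : (B2 ⊗[k] (B1 ⊗[k] (B2 ⊗[k] (B2 ⊗[k] B1)))) →ₗ[k] (B2 ⊗[k] (B2 ⊗[k] (B1 ⊗[k] (B2 ⊗[k] B1)))))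
      ∘ₗ ((merge2 actR) : (B2 ⊗[k] (B1 ⊗[k] (B1 ⊗[k] (B2 ⊗[k] (B2 ⊗[k] B1))))) →ₗ[k] (B2 ⊗[k] (B1 ⊗[k] (B2 ⊗[k] (B2 ⊗[k] B1)))))
      ∘ₗ ((skp (skp (skp swap2))) : (B2 ⊗[k] (B1 ⊗[k] (B1 ⊗[k] (B2 ⊗[k] (B2 ⊗[k] B1))))) →ₗ[k] (B2 ⊗[k] (B1 ⊗[k] (B1 ⊗[k] (B2 ⊗[k] (B2 ⊗[k] B1))))))
      ∘ₗ ((skp swap2) : (B2 ⊗[k] (B1 ⊗[k] (B1 ⊗[k] (B2 ⊗[k] (B2 ⊗[k] B1))))) →ₗ[k] (B2 ⊗[k] (B1 ⊗[k] (B1 ⊗[k] (B2 ⊗[k] (B2 ⊗[k] B1))))))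
      ∘ₗ ((skp (skp (skp (skp coactL)))) : (B2 ⊗[k] (B1 ⊗[k] (B1 ⊗[k] (B2 ⊗[k] B1)))) →ₗ[k] (B2 ⊗[k] (B1 ⊗[k] (B1 ⊗[k] (B2 ⊗[k] (B2 ⊗[k] B1))))))
      ∘ₗ ((skp (skp swap2)) : (B2 ⊗[k] (B1 ⊗[k] (B2 ⊗[k] (B1 ⊗[k] B1)))) →ₗ[k] (B2 ⊗[k] (B1 ⊗[k] (B1 ⊗[k] (B2 ⊗[k] B1)))))
      ∘ₗ ((split2 coactR) : (B2 ⊗[k] (B2 ⊗[k] (B1 ⊗[k] B1))) →ₗ[k] (B2 ⊗[k] (B1 ⊗[k] (B2 ⊗[k] (B1 ⊗[k] B1)))))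
      ∘ₗ ((skp (skp delta1)) : (B2 ⊗[k] (B2 ⊗[k] B1)) →ₗ[k] (B2 ⊗[k] (B2 ⊗[k] (B1 ⊗[k] B1))))
      ∘ₗ ((split2 delta2) : (B2 ⊗[k] B1) →ₗ[k] (B2 ⊗[k] (B2 ⊗[k] B1)))

noncomputable def ax_modAlg1 (m1 : (B1 ⊗[k] B1) →ₗ[k] B1) (eta1 : k →ₗ[k] B1)
    (delta1 : B1 →ₗ[k] (B1 ⊗[k] B1)) (eps1 : B1 →ₗ[k] k)
    (m2 : (B2 ⊗[k] B2) →ₗ[k] B2) (eta2 : k →ₗ[k] B2)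
    (delta2 : B2 →ₗ[k] (B2 ⊗[k] B2)) (eps2 : B2 →ₗ[k] k)
    (actL : (B2 ⊗[k] B1) →ₗ[k] B1) (coactL : B1 →ₗ[k] (B2 ⊗[k] B1))
    (actR : (B2 ⊗[k] B1) →ₗ[k] B2) (coactR : B2 →ₗ[k] (B2 ⊗[k] B1)) : Prop :=
    (actR : (B2 ⊗[k] B1) →ₗ[k] B2)
      ∘ₗ ((merge2 m2) : (B2 ⊗[k] (B2 ⊗[k] B1)) →ₗ[k] (B2 ⊗[k] B1))
    =
    (m2 : (B2 ⊗[k] B2) →ₗ[k] B2)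
      ∘ₗ ((merge2 actR) : (B2 ⊗[k] (B1 ⊗[k] B2)) →ₗ[k] (B2 ⊗[k] B2))
      ∘ₗ ((skp (skp actR)) : (B2 ⊗[k] (B1 ⊗[k] (B2 ⊗[k] B1))) →ₗ[k] (B2 ⊗[k] (B1 ⊗[k] B2)))
      ∘ₗ ((skp (merge2 actL)) : (B2 ⊗[k] (B2 ⊗[k] (B1 ⊗[k] (B2 ⊗[k] B1)))) →ₗ[k] (B2 ⊗[k] (B1 ⊗[k] (B2 ⊗[k] B1))))
      ∘ₗ ((skp (skp swap2)) : (B2 ⊗[k] (B2 ⊗[k] (B2 ⊗[k] (B1 ⊗[k] B1)))) →ₗ[k] (B2 ⊗[k] (B2 ⊗[k] (B1 ⊗[k] (B2 ⊗[k] B1)))))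
      ∘ₗ ((skp (skp (skp delta1))) : (B2 ⊗[k] (B2 ⊗[k] (B2 ⊗[k] B1))) →ₗ[k] (B2 ⊗[k] (B2 ⊗[k] (B2 ⊗[k] (B1 ⊗[k] B1)))))
      ∘ₗ ((skp (split2 delta2)) : (B2 ⊗[k] (B2 ⊗[k] B1)) →ₗ[k] (B2 ⊗[k] (B2 ⊗[k] (B2 ⊗[k] B1))))

noncomputable def ax_modAlg2 (m1 : (B1 ⊗[k] B1) →ₗ[k] B1) (eta1 : k →ₗ[k] B1)
    (delta1 : B1 →ₗ[k] (B1 ⊗[k] B1)) (eps1 : B1 →ₗ[k] k)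
    (m2 : (B2 ⊗[k] B2) →ₗ[k] B2) (eta2 : k →ₗ[k] B2)
    (delta2 : B2 →ₗ[k] (B2 ⊗[k] B2)) (eps2 : B2 →ₗ[k] k)
    (actL : (B2 ⊗[k] B1) →ₗ[k] B1) (coactL : B1 →ₗ[k] (B2 ⊗[k] B1))
    (actR : (B2 ⊗[k] B1) →ₗ[k] B2) (coactR : B2 →ₗ[k] (B2 ⊗[k] B1)) : Prop :=
    (actL : (B2 ⊗[k] B1) →ₗ[k] B1)
      ∘ₗ ((skp m1) : (B2 ⊗[k] (B1 ⊗[k] B1)) →ₗ[k] (B2 ⊗[k] B1))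
    =
    (m1 : (B1 ⊗[k] B1) →ₗ[k] B1)
      ∘ₗ ((skp actL) : (B1 ⊗[k] (B2 ⊗[k] B1)) →ₗ[k] (B1 ⊗[k] B1))
      ∘ₗ ((skp (merge2 actR)) : (B1 ⊗[k] (B2 ⊗[k] (B1 ⊗[k] B1))) →ₗ[k] (B1 ⊗[k] (B2 ⊗[k] B1)))
      ∘ₗ ((merge2 actL) : (B2 ⊗[k] (B1 ⊗[k] (B2 ⊗[k] (B1 ⊗[k] B1)))) →ₗ[k] (B1 ⊗[k] (B2 ⊗[k] (B1 ⊗[k] B1))))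
      ∘ₗ ((skp swap2) : (B2 ⊗[k] (B2 ⊗[k] (B1 ⊗[k] (B1 ⊗[k] B1)))) →ₗ[k] (B2 ⊗[k] (B1 ⊗[k] (B2 ⊗[k] (B1 ⊗[k] B1)))))
      ∘ₗ ((skp (skp (split2 delta1))) : (B2 ⊗[k] (B2 ⊗[k] (B1 ⊗[k] B1))) →ₗ[k] (B2 ⊗[k] (B2 ⊗[k] (B1 ⊗[k] (B1 ⊗[k] B1)))))
      ∘ₗ ((split2 delta2) : (B2 ⊗[k] (B1 ⊗[k] B1)) →ₗ[k] (B2 ⊗[k] (B2 ⊗[k] (B1 ⊗[k] B1))))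

noncomputable def ax_comodCoalg1 (m1 : (B1 ⊗[k] B1) →ₗ[k] B1) (eta1 : k →ₗ[k] B1)
    (delta1 : B1 →ₗ[k] (B1 ⊗[k] B1)) (eps1 : B1 →ₗ[k] k)
    (m2 : (B2 ⊗[k] B2) →ₗ[k] B2) (eta2 : k →ₗ[k] B2)
    (delta2 : B2 →ₗ[k] (B2 ⊗[k] B2)) (eps2 : B2 →ₗ[k] k)
    (actL : (B2 ⊗[k] B1) →ₗ[k] B1) (coactL : B1 →ₗ[k] (B2 ⊗[k] B1))
    (actR : (B2 ⊗[k] B1) →ₗ[k] B2) (coactR : B2 →ₗ[k] (B2 ⊗[k] B1)) : Prop :=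
    ((split2 delta2) : (B2 ⊗[k] B1) →ₗ[k] (B2 ⊗[k] (B2 ⊗[k] B1)))
      ∘ₗ (coactR : B2 →ₗ[k] (B2 ⊗[k] B1))
    =
    ((skp (skp m1)) : (B2 ⊗[k] (B2 ⊗[k] (B1 ⊗[k] B1))) →ₗ[k] (B2 ⊗[k] (B2 ⊗[k] B1)))
      ∘ₗ ((skp (merge2 m2)) : (B2 ⊗[k] (B2 ⊗[k] (B2 ⊗[k] (B1 ⊗[k] B1)))) →ₗ[k] (B2 ⊗[k] (B2 ⊗[k] (B1 ⊗[k] B1))))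
      ∘ₗ ((skp (skp swap2)) : (B2 ⊗[k] (B2 ⊗[k] (B1 ⊗[k] (B2 ⊗[k] B1)))) →ₗ[k] (B2 ⊗[k] (B2 ⊗[k] (B2 ⊗[k] (B1 ⊗[k] B1)))))
      ∘ₗ ((skp (skp (skp coactR))) : (B2 ⊗[k] (B2 ⊗[k] (B1 ⊗[k] B2))) →ₗ[k] (B2 ⊗[k] (B2 ⊗[k] (B1 ⊗[k] (B2 ⊗[k] B1)))))
      ∘ₗ ((skp (split2 coactL)) : (B2 ⊗[k] (B1 ⊗[k] B2)) →ₗ[k] (B2 ⊗[k] (B2 ⊗[k] (B1 ⊗[k] B2))))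
      ∘ₗ ((split2 coactR) : (B2 ⊗[k] B2) →ₗ[k] (B2 ⊗[k] (B1 ⊗[k] B2)))
      ∘ₗ (delta2 : B2 →ₗ[k] (B2 ⊗[k] B2))

noncomputable def ax_comodCoalg2 (m1 : (B1 ⊗[k] B1) →ₗ[k] B1) (eta1 : k →ₗ[k] B1)
    (delta1 : B1 →ₗ[k] (B1 ⊗[k] B1)) (eps1 : B1 →ₗ[k] k)
    (m2 : (B2 ⊗[k] B2) →ₗ[k] B2) (eta2 : k →ₗ[k] B2)
    (delta2 : B2 →ₗ[k] (B2 ⊗[k] B2)) (eps2 : B2 →ₗ[k] k)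
    (actL : (B2 ⊗[k] B1) →ₗ[k] B1) (coactL : B1 →ₗ[k] (B2 ⊗[k] B1))
    (actR : (B2 ⊗[k] B1) →ₗ[k] B2) (coactR : B2 →ₗ[k] (B2 ⊗[k] B1)) : Prop :=
    ((skp delta1) : (B2 ⊗[k] B1) →ₗ[k] (B2 ⊗[k] (B1 ⊗[k] B1)))
      ∘ₗ (coactL : B1 →ₗ[k] (B2 ⊗[k] B1))
    =
    ((skp (merge2 m1)) : (B2 ⊗[k] (B1 ⊗[k] (B1 ⊗[k] B1))) →ₗ[k] (B2 ⊗[k] (B1 ⊗[k] B1)))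
      ∘ₗ ((merge2 m2) : (B2 ⊗[k] (B2 ⊗[k] (B1 ⊗[k] (B1 ⊗[k] B1)))) →ₗ[k] (B2 ⊗[k] (B1 ⊗[k] (B1 ⊗[k] B1))))
      ∘ₗ ((skp swap2) : (B2 ⊗[k] (B1 ⊗[k] (B2 ⊗[k] (B1 ⊗[k] B1)))) →ₗ[k] (B2 ⊗[k] (B2 ⊗[k] (B1 ⊗[k] (B1 ⊗[k] B1)))))
      ∘ₗ ((skp (skp (split2 coactR))) : (B2 ⊗[k] (B1 ⊗[k] (B2 ⊗[k] B1))) →ₗ[k] (B2 ⊗[k] (B1 ⊗[k] (B2 ⊗[k] (B1 ⊗[k] B1)))))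
      ∘ₗ ((skp (skp coactL)) : (B2 ⊗[k] (B1 ⊗[k] B1)) →ₗ[k] (B2 ⊗[k] (B1 ⊗[k] (B2 ⊗[k] B1))))
      ∘ₗ ((split2 coactL) : (B1 ⊗[k] B1) →ₗ[k] (B2 ⊗[k] (B1 ⊗[k] B1)))
      ∘ₗ (delta1 : B1 →ₗ[k] (B1 ⊗[k] B1))

noncomputable def ax_modCoalg1 (m1 : (B1 ⊗[k] B1) →ₗ[k] B1) (eta1 : k →ₗ[k] B1)
    (delta1 : B1 →ₗ[k] (B1 ⊗[k] B1)) (eps1 : B1 →ₗ[k] k)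
    (m2 : (B2 ⊗[k] B2) →ₗ[k] B2) (eta2 : k →ₗ[k] B2)
    (delta2 : B2 →ₗ[k] (B2 ⊗[k] B2)) (eps2 : B2 →ₗ[k] k)
    (actL : (B2 ⊗[k] B1) →ₗ[k] B1) (coactL : B1 →ₗ[k] (B2 ⊗[k] B1))
    (actR : (B2 ⊗[k] B1) →ₗ[k] B2) (coactR : B2 →ₗ[k] (B2 ⊗[k] B1)) : Prop :=
    (delta2 : B2 →ₗ[k] (B2 ⊗[k] B2))
      ∘ₗ (actR : (B2 ⊗[k] B1) →ₗ[k] B2)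
    =
    ((merge2 m2) : (B2 ⊗[k] (B2 ⊗[k] B2)) →ₗ[k] (B2 ⊗[k] B2))
      ∘ₗ ((skp (skp actR)) : (B2 ⊗[k] (B2 ⊗[k] (B2 ⊗[k] B1))) →ₗ[k] (B2 ⊗[k] (B2 ⊗[k] B2)))
      ∘ₗ ((skp swap2) : (B2 ⊗[k] (B2 ⊗[k] (B2 ⊗[k] B1))) →ₗ[k] (B2 ⊗[k] (B2 ⊗[k] (B2 ⊗[k] B1))))
      ∘ₗ ((merge2 actR) : (B2 ⊗[k] (B1 ⊗[k] (B2 ⊗[k] (B2 ⊗[k] B1)))) →ₗ[k] (B2 ⊗[k] (B2 ⊗[k] (B2 ⊗[k] B1))))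
      ∘ₗ ((skp (skp (skp coactL))) : (B2 ⊗[k] (B1 ⊗[k] (B2 ⊗[k] B1))) →ₗ[k] (B2 ⊗[k] (B1 ⊗[k] (B2 ⊗[k] (B2 ⊗[k] B1)))))
      ∘ₗ ((skp swap2) : (B2 ⊗[k] (B2 ⊗[k] (B1 ⊗[k] B1))) →ₗ[k] (B2 ⊗[k] (B1 ⊗[k] (B2 ⊗[k] B1))))
      ∘ₗ ((skp (skp delta1)) : (B2 ⊗[k] (B2 ⊗[k] B1)) →ₗ[k] (B2 ⊗[k] (B2 ⊗[k] (B1 ⊗[k] B1))))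
      ∘ₗ ((split2 delta2) : (B2 ⊗[k] B1) →ₗ[k] (B2 ⊗[k] (B2 ⊗[k] B1)))

noncomputable def ax_modCoalg2 (m1 : (B1 ⊗[k] B1) →ₗ[k] B1) (eta1 : k →ₗ[k] B1)
    (delta1 : B1 →ₗ[k] (B1 ⊗[k] B1)) (eps1 : B1 →ₗ[k] k)
    (m2 : (B2 ⊗[k] B2) →ₗ[k] B2) (eta2 : k →ₗ[k] B2)
    (delta2 : B2 →ₗ[k] (B2 ⊗[k] B2)) (eps2 : B2 →ₗ[k] k)
    (actL : (B2 ⊗[k] B1) →ₗ[k] B1) (coactL : B1 →ₗ[k] (B2 ⊗[k] B1))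
    (actR : (B2 ⊗[k] B1) →ₗ[k] B2) (coactR : B2 →ₗ[k] (B2 ⊗[k] B1)) : Prop :=
    (delta1 : B1 →ₗ[k] (B1 ⊗[k] B1))
      ∘ₗ (actL : (B2 ⊗[k] B1) →ₗ[k] B1)
    =
    ((skp m1) : (B1 ⊗[k] (B1 ⊗[k] B1)) →ₗ[k] (B1 ⊗[k] B1))
      ∘ₗ ((skp (skp actL)) : (B1 ⊗[k] (B1 ⊗[k] (B2 ⊗[k] B1))) →ₗ[k] (B1 ⊗[k] (B1 ⊗[k] B1)))
      ∘ₗ ((merge2 actL) : (B2 ⊗[k] (B1 ⊗[k] (B1 ⊗[k] (B2 ⊗[k] B1)))) →ₗ[k] (B1 ⊗[k] (B1 ⊗[k] (B2 ⊗[k] B1))))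
      ∘ₗ ((skp swap2) : (B2 ⊗[k] (B1 ⊗[k] (B1 ⊗[k] (B2 ⊗[k] B1)))) →ₗ[k] (B2 ⊗[k] (B1 ⊗[k] (B1 ⊗[k] (B2 ⊗[k] B1)))))
      ∘ₗ ((split2 coactR) : (B2 ⊗[k] (B1 ⊗[k] (B2 ⊗[k] B1))) →ₗ[k] (B2 ⊗[k] (B1 ⊗[k] (B1 ⊗[k] (B2 ⊗[k] B1)))))
      ∘ₗ ((skp swap2) : (B2 ⊗[k] (B2 ⊗[k] (B1 ⊗[k] B1))) →ₗ[k] (B2 ⊗[k] (B1 ⊗[k] (B2 ⊗[k] B1))))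
      ∘ₗ ((skp (skp delta1)) : (B2 ⊗[k] (B2 ⊗[k] B1)) →ₗ[k] (B2 ⊗[k] (B2 ⊗[k] (B1 ⊗[k] B1))))
      ∘ₗ ((split2 delta2) : (B2 ⊗[k] B1) →ₗ[k] (B2 ⊗[k] (B2 ⊗[k] B1)))

noncomputable def ax_comodAlg1 (m1 : (B1 ⊗[k] B1) →ₗ[k] B1) (eta1 : k →ₗ[k] B1)
    (delta1 : B1 →ₗ[k] (B1 ⊗[k] B1)) (eps1 : B1 →ₗ[k] k)
    (m2 : (B2 ⊗[k] B2) →ₗ[k] B2) (eta2 : k →ₗ[k] B2)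
    (delta2 : B2 →ₗ[k] (B2 ⊗[k] B2)) (eps2 : B2 →ₗ[k] k)
    (actL : (B2 ⊗[k] B1) →ₗ[k] B1) (coactL : B1 →ₗ[k] (B2 ⊗[k] B1))
    (actR : (B2 ⊗[k] B1) →ₗ[k] B2) (coactR : B2 →ₗ[k] (B2 ⊗[k] B1)) : Prop :=
    (coactR : B2 →ₗ[k] (B2 ⊗[k] B1))
      ∘ₗ (m2 : (B2 ⊗[k] B2) →ₗ[k] B2)
    =
    ((skp m1) : (B2 ⊗[k] (B1 ⊗[k] B1)) →ₗ[k] (B2 ⊗[k] B1))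
      ∘ₗ ((skp (skp actL)) : (B2 ⊗[k] (B1 ⊗[k] (B2 ⊗[k] B1))) →ₗ[k] (B2 ⊗[k] (B1 ⊗[k] B1)))
      ∘ₗ ((merge2 m2) : (B2 ⊗[k] (B2 ⊗[k] (B1 ⊗[k] (B2 ⊗[k] B1)))) →ₗ[k] (B2 ⊗[k] (B1 ⊗[k] (B2 ⊗[k] B1))))
      ∘ₗ ((skp swap2) : (B2 ⊗[k] (B1 ⊗[k] (B2 ⊗[k] (B2 ⊗[k] B1)))) →ₗ[k] (B2 ⊗[k] (B2 ⊗[k] (B1 ⊗[k] (B2 ⊗[k] B1)))))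
      ∘ₗ ((skp (skp swap2)) : (B2 ⊗[k] (B1 ⊗[k] (B2 ⊗[k] (B2 ⊗[k] B1)))) →ₗ[k] (B2 ⊗[k] (B1 ⊗[k] (B2 ⊗[k] (B2 ⊗[k] B1)))))
      ∘ₗ ((skp (skp (skp coactR))) : (B2 ⊗[k] (B1 ⊗[k] (B2 ⊗[k] B2))) →ₗ[k] (B2 ⊗[k] (B1 ⊗[k] (B2 ⊗[k] (B2 ⊗[k] B1)))))
      ∘ₗ ((split2 coactR) : (B2 ⊗[k] (B2 ⊗[k] B2)) →ₗ[k] (B2 ⊗[k] (B1 ⊗[k] (B2 ⊗[k] B2))))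
      ∘ₗ ((split2 delta2) : (B2 ⊗[k] B2) →ₗ[k] (B2 ⊗[k] (B2 ⊗[k] B2)))

noncomputable def ax_comodAlg2 (m1 : (B1 ⊗[k] B1) →ₗ[k] B1) (eta1 : k →ₗ[k] B1)
    (delta1 : B1 →ₗ[k] (B1 ⊗[k] B1)) (eps1 : B1 →ₗ[k] k)
    (m2 : (B2 ⊗[k] B2) →ₗ[k] B2) (eta2 : k →ₗ[k] B2)
    (delta2 : B2 →ₗ[k] (B2 ⊗[k] B2)) (eps2 : B2 →ₗ[k] k)
    (actL : (B2 ⊗[k] B1) →ₗ[k] B1) (coactL : B1 →ₗ[k] (B2 ⊗[k] B1))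
    (actR : (B2 ⊗[k] B1) →ₗ[k] B2) (coactR : B2 →ₗ[k] (B2 ⊗[k] B1)) : Prop :=
    (coactL : B1 →ₗ[k] (B2 ⊗[k] B1))
      ∘ₗ (m1 : (B1 ⊗[k] B1) →ₗ[k] B1)
    =
    ((skp m1) : (B2 ⊗[k] (B1 ⊗[k] B1)) →ₗ[k] (B2 ⊗[k] B1))
      ∘ₗ ((merge2 m2) : (B2 ⊗[k] (B2 ⊗[k] (B1 ⊗[k] B1))) →ₗ[k] (B2 ⊗[k] (B1 ⊗[k] B1)))
      ∘ₗ ((skp swap2) : (B2 ⊗[k] (B1 ⊗[k] (B2 ⊗[k] B1))) →ₗ[k] (B2 ⊗[k] (B2 ⊗[k] (B1 ⊗[k] B1))))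
      ∘ₗ ((skp (skp coactL)) : (B2 ⊗[k] (B1 ⊗[k] B1)) →ₗ[k] (B2 ⊗[k] (B1 ⊗[k] (B2 ⊗[k] B1))))
      ∘ₗ ((merge2 actR) : (B2 ⊗[k] (B1 ⊗[k] (B1 ⊗[k] B1))) →ₗ[k] (B2 ⊗[k] (B1 ⊗[k] B1)))
      ∘ₗ ((skp swap2) : (B2 ⊗[k] (B1 ⊗[k] (B1 ⊗[k] B1))) →ₗ[k] (B2 ⊗[k] (B1 ⊗[k] (B1 ⊗[k] B1))))
      ∘ₗ ((skp (skp delta1)) : (B2 ⊗[k] (B1 ⊗[k] B1)) →ₗ[k] (B2 ⊗[k] (B1 ⊗[k] (B1 ⊗[k] B1))))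
      ∘ₗ ((split2 coactL) : (B1 ⊗[k] B1) →ₗ[k] (B2 ⊗[k] (B1 ⊗[k] B1)))


/-- A Hopf datum in the sense of Definition 2.5 of Bespalov-Drabant,
"Cross Product Bialgebras I", in the symmetric monoidal category of `k`-modules:
two objects which are both (counital) algebras and (unital) coalgebras, `B1` a left
`B2`-module and -comodule, `B2` a right `B1`-module and -comodule, subject to the
algebra-coalgebra, module-comodule, module-algebra, comodule-coalgebra, module-coalgebra
and comodule-algebra compatibilities. -/
structure HopfDatum where
  m1 : (B1 ⊗[k] B1) →ₗ[k] B1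
  eta1 : k →ₗ[k] B1
  delta1 : B1 →ₗ[k] (B1 ⊗[k] B1)
  eps1 : B1 →ₗ[k] k
  m2 : (B2 ⊗[k] B2) →ₗ[k] B2
  eta2 : k →ₗ[k] B2
  delta2 : B2 →ₗ[k] (B2 ⊗[k] B2)
  eps2 : B2 →ₗ[k] k
  actL : (B2 ⊗[k] B1) →ₗ[k] B1
  coactL : B1 →ₗ[k] (B2 ⊗[k] B1)
  actR : (B2 ⊗[k] B1) →ₗ[k] B2
  coactR : B2 →ₗ[k] (B2 ⊗[k] B1)
  alg1 : IsAlgMaps k B1 m1 eta1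
  coalg1 : IsCoalgMaps k B1 delta1 eps1
  alg2 : IsAlgMaps k B2 m2 eta2
  coalg2 : IsCoalgMaps k B2 delta2 eps2
  epseta1 : eps1 ∘ₗ eta1 = LinearMap.id
  epseta2 : eps2 ∘ₗ eta2 = LinearMap.id
  actL_act : ax_actL_act k B1 B2 m1 eta1 delta1 eps1 m2 eta2 delta2 eps2 actL coactL actR coactR
  actL_unit : ax_actL_unit k B1 B2 m1 eta1 delta1 eps1 m2 eta2 delta2 eps2 actL coactL actR coactR
  actR_act : ax_actR_act k B1 B2 m1 eta1 delta1 eps1 m2 eta2 delta2 eps2 actL coactL actR coactR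
  actR_unit : ax_actR_unit k B1 B2 m1 eta1 delta1 eps1 m2 eta2 delta2 eps2 actL coactL actR coactR
  coactL_coact : ax_coactL_coact k B1 B2 m1 eta1 delta1 eps1 m2 eta2 delta2 eps2 actL coactL actR coactR
  coactL_counit : ax_coactL_counit k B1 B2 m1 eta1 delta1 eps1 m2 eta2 delta2 eps2 actL coactL actR coactR
  coactR_coact : ax_coactR_coact k B1 B2 m1 eta1 delta1 eps1 m2 eta2 delta2 eps2 actL coactL actR coactR
  coactR_counit : ax_coactR_counit k B1 B2 m1 eta1 delta1 eps1 m2 eta2 delta2 eps2 actL coactL actR coactR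
  actR_eta2 : ax_actR_eta2 k B1 B2 m1 eta1 delta1 eps1 m2 eta2 delta2 eps2 actL coactL actR coactR
  coactL_eps1 : ax_coactL_eps1 k B1 B2 m1 eta1 delta1 eps1 m2 eta2 delta2 eps2 actL coactL actR coactR
  eps2_actR : ax_eps2_actR k B1 B2 m1 eta1 delta1 eps1 m2 eta2 delta2 eps2 actL coactL actR coactR
  eps1_actL : ax_eps1_actL k B1 B2 m1 eta1 delta1 eps1 m2 eta2 delta2 eps2 actL coactL actR coactR
  actL_eta1 : ax_actL_eta1 k B1 B2 m1 eta1 delta1 eps1 m2 eta2 delta2 eps2 actL coactL actR coactR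
  coactR_eps2 : ax_coactR_eps2 k B1 B2 m1 eta1 delta1 eps1 m2 eta2 delta2 eps2 actL coactL actR coactR
  coactR_eta2 : ax_coactR_eta2 k B1 B2 m1 eta1 delta1 eps1 m2 eta2 delta2 eps2 actL coactL actR coactR
  coactL_eta1 : ax_coactL_eta1 k B1 B2 m1 eta1 delta1 eps1 m2 eta2 delta2 eps2 actL coactL actR coactR
  algCoalg1 : ax_algCoalg1 k B1 B2 m1 eta1 delta1 eps1 m2 eta2 delta2 eps2 actL coactL actR coactR
  algCoalg2 : ax_algCoalg2 k B1 B2 m1 eta1 delta1 eps1 m2 eta2 delta2 eps2 actL coactL actR coactR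
  modComod : ax_modComod k B1 B2 m1 eta1 delta1 eps1 m2 eta2 delta2 eps2 actL coactL actR coactR
  modAlg1 : ax_modAlg1 k B1 B2 m1 eta1 delta1 eps1 m2 eta2 delta2 eps2 actL coactL actR coactR
  modAlg2 : ax_modAlg2 k B1 B2 m1 eta1 delta1 eps1 m2 eta2 delta2 eps2 actL coactL actR coactR
  comodCoalg1 : ax_comodCoalg1 k B1 B2 m1 eta1 delta1 eps1 m2 eta2 delta2 eps2 actL coactL actR coactR
  comodCoalg2 : ax_comodCoalg2 k B1 B2 m1 eta1 delta1 eps1 m2 eta2 delta2 eps2 actL coactL actR coactR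
  modCoalg1 : ax_modCoalg1 k B1 B2 m1 eta1 delta1 eps1 m2 eta2 delta2 eps2 actL coactL actR coactR
  modCoalg2 : ax_modCoalg2 k B1 B2 m1 eta1 delta1 eps1 m2 eta2 delta2 eps2 actL coactL actR coactR
  comodAlg1 : ax_comodAlg1 k B1 B2 m1 eta1 delta1 eps1 m2 eta2 delta2 eps2 actL coactL actR coactR
  comodAlg2 : ax_comodAlg2 k B1 B2 m1 eta1 delta1 eps1 m2 eta2 delta2 eps2 actL coactL actR coactR

end HopfDatumSection


section Derived
variable {k : Type*} [CommRing k] {B1 B2 : Type*}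
  [AddCommMonoid B1] [Module k B1] [AddCommMonoid B2] [Module k B2]

/-- `φ₂₁ = (μ_l ⊗ μ_r) ∘ (id ⊗ τ ⊗ id) ∘ (Δ₂ ⊗ Δ₁)` -/
noncomputable def mpPhi21 (delta1 : B1 →ₗ[k] (B1 ⊗[k] B1)) (delta2 : B2 →ₗ[k] (B2 ⊗[k] B2))
    (actL : (B2 ⊗[k] B1) →ₗ[k] B1) (actR : (B2 ⊗[k] B1) →ₗ[k] B2) :
    (B2 ⊗[k] B1) →ₗ[k] (B1 ⊗[k] B2) :=
  ((skp actR) : (B1 ⊗[k] (B2 ⊗[k] B1)) →ₗ[k] (B1 ⊗[k] B2))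
      ∘ₗ ((merge2 actL) : (B2 ⊗[k] (B1 ⊗[k] (B2 ⊗[k] B1))) →ₗ[k] (B1 ⊗[k] (B2 ⊗[k] B1)))
      ∘ₗ ((skp swap2) : (B2 ⊗[k] (B2 ⊗[k] (B1 ⊗[k] B1))) →ₗ[k] (B2 ⊗[k] (B1 ⊗[k] (B2 ⊗[k] B1))))
      ∘ₗ ((skp (skp delta1)) : (B2 ⊗[k] (B2 ⊗[k] B1)) →ₗ[k] (B2 ⊗[k] (B2 ⊗[k] (B1 ⊗[k] B1))))
      ∘ₗ ((split2 delta2) : (B2 ⊗[k] B1) →ₗ[k] (B2 ⊗[k] (B2 ⊗[k] B1)))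

/-- `φ₁₂ = (m₂ ⊗ m₁) ∘ (id ⊗ τ ⊗ id) ∘ (ν_l ⊗ ν_r)` -/
noncomputable def mpPhi12 (m1 : (B1 ⊗[k] B1) →ₗ[k] B1) (m2 : (B2 ⊗[k] B2) →ₗ[k] B2)
    (coactL : B1 →ₗ[k] (B2 ⊗[k] B1)) (coactR : B2 →ₗ[k] (B2 ⊗[k] B1)) :
    (B1 ⊗[k] B2) →ₗ[k] (B2 ⊗[k] B1) :=
  ((skp m1) : (B2 ⊗[k] (B1 ⊗[k] B1)) →ₗ[k] (B2 ⊗[k] B1))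
      ∘ₗ ((merge2 m2) : (B2 ⊗[k] (B2 ⊗[k] (B1 ⊗[k] B1))) →ₗ[k] (B2 ⊗[k] (B1 ⊗[k] B1)))
      ∘ₗ ((skp swap2) : (B2 ⊗[k] (B1 ⊗[k] (B2 ⊗[k] B1))) →ₗ[k] (B2 ⊗[k] (B2 ⊗[k] (B1 ⊗[k] B1))))
      ∘ₗ ((skp (skp coactR)) : (B2 ⊗[k] (B1 ⊗[k] B2)) →ₗ[k] (B2 ⊗[k] (B1 ⊗[k] (B2 ⊗[k] B1))))
      ∘ₗ ((split2 coactL) : (B1 ⊗[k] B2) →ₗ[k] (B2 ⊗[k] (B1 ⊗[k] B2)))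


variable (hd : HopfDatum k B1 B2)

/-- the morphism `φ₂₁` canonically associated with a Hopf datum -/
noncomputable def hdPhi21 : (B2 ⊗[k] B1) →ₗ[k] (B1 ⊗[k] B2) :=
  mpPhi21 hd.delta1 hd.delta2 hd.actL hd.actR

/-- the morphism `φ₁₂` canonically associated with a Hopf datum -/
noncomputable def hdPhi12 : (B1 ⊗[k] B2) →ₗ[k] (B2 ⊗[k] B1) :=
  mpPhi12 hd.m1 hd.m2 hd.coactL hd.coactR

/-- the multiplication on `B₁ ⊗ B₂` associated with a Hopf datum (Proposition 2.6) -/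
noncomputable def hdMul : ((B1 ⊗[k] B2) ⊗[k] (B1 ⊗[k] B2)) →ₗ[k] (B1 ⊗[k] B2) :=
  crossMul hd.m1 hd.m2 (hdPhi21 hd)

/-- the unit on `B₁ ⊗ B₂` associated with a Hopf datum -/
noncomputable def hdUnit : k →ₗ[k] (B1 ⊗[k] B2) := crossUnit hd.eta1 hd.eta2

/-- the comultiplication on `B₁ ⊗ B₂` associated with a Hopf datum (Proposition 2.6) -/
noncomputable def hdComul : (B1 ⊗[k] B2) →ₗ[k] ((B1 ⊗[k] B2) ⊗[k] (B1 ⊗[k] B2)) :=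
  crossComul hd.delta1 hd.delta2 (hdPhi12 hd)

/-- the counit on `B₁ ⊗ B₂` associated with a Hopf datum -/
noncomputable def hdCounit : (B1 ⊗[k] B2) →ₗ[k] k := crossCounit hd.eps1 hd.eps2

/-- the idempotent `π = (η₁ ∘ ε₁) ⊗ id ⊗ id ⊗ (η₂ ∘ ε₂)` on `B₁ ⊗ B₂ ⊗ B₁ ⊗ B₂` -/
noncomputable def piMap : (B1 ⊗[k] (B2 ⊗[k] (B1 ⊗[k] B2))) →ₗ[k]
    (B1 ⊗[k] (B2 ⊗[k] (B1 ⊗[k] B2))) :=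
  TensorProduct.map (hd.eta1 ∘ₗ hd.eps1)
    (TensorProduct.map LinearMap.id (TensorProduct.map LinearMap.id (hd.eta2 ∘ₗ hd.eps2)))

/-- the recursion operator `Φ` of Definition 2.10 / eq. (2.11) of Bespalov-Drabant,
"Cross Product Bialgebras I", associated with a Hopf datum -/
noncomputable def Phi (f : (B1 ⊗[k] (B2 ⊗[k] (B1 ⊗[k] B2))) →ₗ[k]
    (B1 ⊗[k] (B2 ⊗[k] (B1 ⊗[k] B2)))) :
    (B1 ⊗[k] (B2 ⊗[k] (B1 ⊗[k] B2))) →ₗ[k] (B1 ⊗[k] (B2 ⊗[k] (B1 ⊗[k] B2))) :=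
  ((skp (skp (merge2 hd.m1))) : (B1 ⊗[k] (B2 ⊗[k] (B1 ⊗[k] (B1 ⊗[k] B2)))) →ₗ[k] (B1 ⊗[k] (B2 ⊗[k] (B1 ⊗[k] B2))))
      ∘ₗ ((skp (merge2 hd.m2)) : (B1 ⊗[k] (B2 ⊗[k] (B2 ⊗[k] (B1 ⊗[k] (B1 ⊗[k] B2))))) →ₗ[k] (B1 ⊗[k] (B2 ⊗[k] (B1 ⊗[k] (B1 ⊗[k] B2)))))
      ∘ₗ ((skp (skp (skp (skp (merge2 hd.m1))))) : (B1 ⊗[k] (B2 ⊗[k] (B2 ⊗[k] (B1 ⊗[k] (B1 ⊗[k] (B1 ⊗[k] B2)))))) →ₗ[k] (B1 ⊗[k] (B2 ⊗[k] (B2 ⊗[k] (B1 ⊗[k] (B1 ⊗[k] B2))))))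
      ∘ₗ ((skp (skp swap2)) : (B1 ⊗[k] (B2 ⊗[k] (B1 ⊗[k] (B2 ⊗[k] (B1 ⊗[k] (B1 ⊗[k] B2)))))) →ₗ[k] (B1 ⊗[k] (B2 ⊗[k] (B2 ⊗[k] (B1 ⊗[k] (B1 ⊗[k] (B1 ⊗[k] B2)))))))
      ∘ₗ ((skp (merge2 hd.m2)) : (B1 ⊗[k] (B2 ⊗[k] (B2 ⊗[k] (B1 ⊗[k] (B2 ⊗[k] (B1 ⊗[k] (B1 ⊗[k] B2))))))) →ₗ[k] (B1 ⊗[k] (B2 ⊗[k] (B1 ⊗[k] (B2 ⊗[k] (B1 ⊗[k] (B1 ⊗[k] B2)))))))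
      ∘ₗ ((skp (skp (skp (skp (skp (skp (merge2 hd.actL))))))) : (B1 ⊗[k] (B2 ⊗[k] (B2 ⊗[k] (B1 ⊗[k] (B2 ⊗[k] (B1 ⊗[k] (B2 ⊗[k] (B1 ⊗[k] B2)))))))) →ₗ[k] (B1 ⊗[k] (B2 ⊗[k] (B2 ⊗[k] (B1 ⊗[k] (B2 ⊗[k] (B1 ⊗[k] (B1 ⊗[k] B2))))))))
      ∘ₗ ((skp (skp (skp (skp swap2)))) : (B1 ⊗[k] (B2 ⊗[k] (B2 ⊗[k] (B1 ⊗[k] (B1 ⊗[k] (B2 ⊗[k] (B2 ⊗[k] (B1 ⊗[k] B2)))))))) →ₗ[k] (B1 ⊗[k] (B2 ⊗[k] (B2 ⊗[k] (B1 ⊗[k] (B2 ⊗[k] (B1 ⊗[k] (B2 ⊗[k] (B1 ⊗[k] B2)))))))))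
      ∘ₗ ((skp (skp swap2)) : (B1 ⊗[k] (B2 ⊗[k] (B1 ⊗[k] (B2 ⊗[k] (B1 ⊗[k] (B2 ⊗[k] (B2 ⊗[k] (B1 ⊗[k] B2)))))))) →ₗ[k] (B1 ⊗[k] (B2 ⊗[k] (B2 ⊗[k] (B1 ⊗[k] (B1 ⊗[k] (B2 ⊗[k] (B2 ⊗[k] (B1 ⊗[k] B2)))))))))
      ∘ₗ ((skp (merge2 hd.actR)) : (B1 ⊗[k] (B2 ⊗[k] (B1 ⊗[k] (B1 ⊗[k] (B2 ⊗[k] (B1 ⊗[k] (B2 ⊗[k] (B2 ⊗[k] (B1 ⊗[k] B2))))))))) →ₗ[k] (B1 ⊗[k] (B2 ⊗[k] (B1 ⊗[k] (B2 ⊗[k] (B1 ⊗[k] (B2 ⊗[k] (B2 ⊗[k] (B1 ⊗[k] B2)))))))))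
      ∘ₗ ((skp (skp (skp (skp (skp (skp (skp (skp (skp hd.m2))))))))) : (B1 ⊗[k] (B2 ⊗[k] (B1 ⊗[k] (B1 ⊗[k] (B2 ⊗[k] (B1 ⊗[k] (B2 ⊗[k] (B2 ⊗[k] (B1 ⊗[k] (B2 ⊗[k] B2)))))))))) →ₗ[k] (B1 ⊗[k] (B2 ⊗[k] (B1 ⊗[k] (B1 ⊗[k] (B2 ⊗[k] (B1 ⊗[k] (B2 ⊗[k] (B2 ⊗[k] (B1 ⊗[k] B2))))))))))
      ∘ₗ ((skp (skp (skp (skp (skp (skp swap2)))))) : (B1 ⊗[k] (B2 ⊗[k] (B1 ⊗[k] (B1 ⊗[k] (B2 ⊗[k] (B1 ⊗[k] (B2 ⊗[k] (B2 ⊗[k] (B1 ⊗[k] (B2 ⊗[k] B2)))))))))) →ₗ[k] (B1 ⊗[k] (B2 ⊗[k] (B1 ⊗[k] (B1 ⊗[k] (B2 ⊗[k] (B1 ⊗[k] (B2 ⊗[k] (B2 ⊗[k] (B1 ⊗[k] (B2 ⊗[k] B2)))))))))))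
      ∘ₗ ((skp (skp swap2)) : (B1 ⊗[k] (B2 ⊗[k] (B1 ⊗[k] (B1 ⊗[k] (B2 ⊗[k] (B1 ⊗[k] (B2 ⊗[k] (B2 ⊗[k] (B1 ⊗[k] (B2 ⊗[k] B2)))))))))) →ₗ[k] (B1 ⊗[k] (B2 ⊗[k] (B1 ⊗[k] (B1 ⊗[k] (B2 ⊗[k] (B1 ⊗[k] (B2 ⊗[k] (B2 ⊗[k] (B1 ⊗[k] (B2 ⊗[k] B2)))))))))))
      ∘ₗ ((merge2 hd.m1) : (B1 ⊗[k] (B1 ⊗[k] (B2 ⊗[k] (B1 ⊗[k] (B1 ⊗[k] (B2 ⊗[k] (B1 ⊗[k] (B2 ⊗[k] (B2 ⊗[k] (B1 ⊗[k] (B2 ⊗[k] B2))))))))))) →ₗ[k] (B1 ⊗[k] (B2 ⊗[k] (B1 ⊗[k] (B1 ⊗[k] (B2 ⊗[k] (B1 ⊗[k] (B2 ⊗[k] (B2 ⊗[k] (B1 ⊗[k] (B2 ⊗[k] B2)))))))))))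
      ∘ₗ ((skp (skp (skp (skp (skp (skp (skp (skp (skp (skp (merge2 hd.actR))))))))))) : (B1 ⊗[k] (B1 ⊗[k] (B2 ⊗[k] (B1 ⊗[k] (B1 ⊗[k] (B2 ⊗[k] (B1 ⊗[k] (B2 ⊗[k] (B2 ⊗[k] (B1 ⊗[k] (B2 ⊗[k] (B1 ⊗[k] B2)))))))))))) →ₗ[k] (B1 ⊗[k] (B1 ⊗[k] (B2 ⊗[k] (B1 ⊗[k] (B1 ⊗[k] (B2 ⊗[k] (B1 ⊗[k] (B2 ⊗[k] (B2 ⊗[k] (B1 ⊗[k] (B2 ⊗[k] B2))))))))))))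
      ∘ₗ ((skp (skp (skp (skp (skp (skp (skp (skp (split2 hd.coactR))))))))) : (B1 ⊗[k] (B1 ⊗[k] (B2 ⊗[k] (B1 ⊗[k] (B1 ⊗[k] (B2 ⊗[k] (B1 ⊗[k] (B2 ⊗[k] (B2 ⊗[k] (B2 ⊗[k] (B1 ⊗[k] B2))))))))))) →ₗ[k] (B1 ⊗[k] (B1 ⊗[k] (B2 ⊗[k] (B1 ⊗[k] (B1 ⊗[k] (B2 ⊗[k] (B1 ⊗[k] (B2 ⊗[k] (B2 ⊗[k] (B1 ⊗[k] (B2 ⊗[k] (B1 ⊗[k] B2)))))))))))))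
      ∘ₗ ((skp (skp (split2 hd.coactL))) : (B1 ⊗[k] (B1 ⊗[k] (B1 ⊗[k] (B1 ⊗[k] (B2 ⊗[k] (B1 ⊗[k] (B2 ⊗[k] (B2 ⊗[k] (B2 ⊗[k] (B1 ⊗[k] B2)))))))))) →ₗ[k] (B1 ⊗[k] (B1 ⊗[k] (B2 ⊗[k] (B1 ⊗[k] (B1 ⊗[k] (B2 ⊗[k] (B1 ⊗[k] (B2 ⊗[k] (B2 ⊗[k] (B2 ⊗[k] (B1 ⊗[k] B2))))))))))))
      ∘ₗ ((skp (merge2 hd.actL)) : (B1 ⊗[k] (B2 ⊗[k] (B1 ⊗[k] (B1 ⊗[k] (B1 ⊗[k] (B2 ⊗[k] (B1 ⊗[k] (B2 ⊗[k] (B2 ⊗[k] (B2 ⊗[k] (B1 ⊗[k] B2))))))))))) →ₗ[k] (B1 ⊗[k] (B1 ⊗[k] (B1 ⊗[k] (B1 ⊗[k] (B2 ⊗[k] (B1 ⊗[k] (B2 ⊗[k] (B2 ⊗[k] (B2 ⊗[k] (B1 ⊗[k] B2)))))))))))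
      ∘ₗ ((skp (skp (skp (skp (skp (skp (skp (skp swap2)))))))) : (B1 ⊗[k] (B2 ⊗[k] (B1 ⊗[k] (B1 ⊗[k] (B1 ⊗[k] (B2 ⊗[k] (B1 ⊗[k] (B2 ⊗[k] (B2 ⊗[k] (B2 ⊗[k] (B1 ⊗[k] B2))))))))))) →ₗ[k] (B1 ⊗[k] (B2 ⊗[k] (B1 ⊗[k] (B1 ⊗[k] (B1 ⊗[k] (B2 ⊗[k] (B1 ⊗[k] (B2 ⊗[k] (B2 ⊗[k] (B2 ⊗[k] (B1 ⊗[k] B2))))))))))))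
      ∘ₗ ((skp (skp (skp (skp (apply4 f))))) : (B1 ⊗[k] (B2 ⊗[k] (B1 ⊗[k] (B1 ⊗[k] (B1 ⊗[k] (B2 ⊗[k] (B1 ⊗[k] (B2 ⊗[k] (B2 ⊗[k] (B2 ⊗[k] (B1 ⊗[k] B2))))))))))) →ₗ[k] (B1 ⊗[k] (B2 ⊗[k] (B1 ⊗[k] (B1 ⊗[k] (B1 ⊗[k] (B2 ⊗[k] (B1 ⊗[k] (B2 ⊗[k] (B2 ⊗[k] (B2 ⊗[k] (B1 ⊗[k] B2))))))))))))
      ∘ₗ ((skp (skp swap2)) : (B1 ⊗[k] (B2 ⊗[k] (B1 ⊗[k] (B1 ⊗[k] (B1 ⊗[k] (B2 ⊗[k] (B1 ⊗[k] (B2 ⊗[k] (B2 ⊗[k] (B2 ⊗[k] (B1 ⊗[k] B2))))))))))) →ₗ[k] (B1 ⊗[k] (B2 ⊗[k] (B1 ⊗[k] (B1 ⊗[k] (B1 ⊗[k] (B2 ⊗[k] (B1 ⊗[k] (B2 ⊗[k] (B2 ⊗[k] (B2 ⊗[k] (B1 ⊗[k] B2))))))))))))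
      ∘ₗ ((skp (skp (skp (skp (skp (skp (skp (skp (skp (split2 hd.coactR)))))))))) : (B1 ⊗[k] (B2 ⊗[k] (B1 ⊗[k] (B1 ⊗[k] (B1 ⊗[k] (B2 ⊗[k] (B1 ⊗[k] (B2 ⊗[k] (B2 ⊗[k] (B2 ⊗[k] B2)))))))))) →ₗ[k] (B1 ⊗[k] (B2 ⊗[k] (B1 ⊗[k] (B1 ⊗[k] (B1 ⊗[k] (B2 ⊗[k] (B1 ⊗[k] (B2 ⊗[k] (B2 ⊗[k] (B2 ⊗[k] (B1 ⊗[k] B2))))))))))))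
      ∘ₗ ((skp (skp (skp (skp (skp (skp (skp (skp (merge2 hd.actR))))))))) : (B1 ⊗[k] (B2 ⊗[k] (B1 ⊗[k] (B1 ⊗[k] (B1 ⊗[k] (B2 ⊗[k] (B1 ⊗[k] (B2 ⊗[k] (B2 ⊗[k] (B1 ⊗[k] (B2 ⊗[k] B2))))))))))) →ₗ[k] (B1 ⊗[k] (B2 ⊗[k] (B1 ⊗[k] (B1 ⊗[k] (B1 ⊗[k] (B2 ⊗[k] (B1 ⊗[k] (B2 ⊗[k] (B2 ⊗[k] (B2 ⊗[k] B2)))))))))))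
      ∘ₗ ((skp (skp (skp (merge2 hd.actL)))) : (B1 ⊗[k] (B2 ⊗[k] (B1 ⊗[k] (B2 ⊗[k] (B1 ⊗[k] (B1 ⊗[k] (B2 ⊗[k] (B1 ⊗[k] (B2 ⊗[k] (B2 ⊗[k] (B1 ⊗[k] (B2 ⊗[k] B2)))))))))))) →ₗ[k] (B1 ⊗[k] (B2 ⊗[k] (B1 ⊗[k] (B1 ⊗[k] (B1 ⊗[k] (B2 ⊗[k] (B1 ⊗[k] (B2 ⊗[k] (B2 ⊗[k] (B1 ⊗[k] (B2 ⊗[k] B2))))))))))))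
      ∘ₗ ((skp (split2 hd.coactL)) : (B1 ⊗[k] (B1 ⊗[k] (B2 ⊗[k] (B1 ⊗[k] (B1 ⊗[k] (B2 ⊗[k] (B1 ⊗[k] (B2 ⊗[k] (B2 ⊗[k] (B1 ⊗[k] (B2 ⊗[k] B2))))))))))) →ₗ[k] (B1 ⊗[k] (B2 ⊗[k] (B1 ⊗[k] (B2 ⊗[k] (B1 ⊗[k] (B1 ⊗[k] (B2 ⊗[k] (B1 ⊗[k] (B2 ⊗[k] (B2 ⊗[k] (B1 ⊗[k] (B2 ⊗[k] B2)))))))))))))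
      ∘ₗ ((skp (skp (skp (skp (skp (skp (skp (skp (skp (skp hd.delta2)))))))))) : (B1 ⊗[k] (B1 ⊗[k] (B2 ⊗[k] (B1 ⊗[k] (B1 ⊗[k] (B2 ⊗[k] (B1 ⊗[k] (B2 ⊗[k] (B2 ⊗[k] (B1 ⊗[k] B2)))))))))) →ₗ[k] (B1 ⊗[k] (B1 ⊗[k] (B2 ⊗[k] (B1 ⊗[k] (B1 ⊗[k] (B2 ⊗[k] (B1 ⊗[k] (B2 ⊗[k] (B2 ⊗[k] (B1 ⊗[k] (B2 ⊗[k] B2))))))))))))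
      ∘ₗ ((skp (skp (skp (skp (skp (skp (skp swap2))))))) : (B1 ⊗[k] (B1 ⊗[k] (B2 ⊗[k] (B1 ⊗[k] (B1 ⊗[k] (B2 ⊗[k] (B1 ⊗[k] (B2 ⊗[k] (B2 ⊗[k] (B1 ⊗[k] B2)))))))))) →ₗ[k] (B1 ⊗[k] (B1 ⊗[k] (B2 ⊗[k] (B1 ⊗[k] (B1 ⊗[k] (B2 ⊗[k] (B1 ⊗[k] (B2 ⊗[k] (B2 ⊗[k] (B1 ⊗[k] B2)))))))))))
      ∘ₗ ((skp (skp (skp swap2))) : (B1 ⊗[k] (B1 ⊗[k] (B2 ⊗[k] (B1 ⊗[k] (B1 ⊗[k] (B2 ⊗[k] (B1 ⊗[k] (B2 ⊗[k] (B2 ⊗[k] (B1 ⊗[k] B2)))))))))) →ₗ[k] (B1 ⊗[k] (B1 ⊗[k] (B2 ⊗[k] (B1 ⊗[k] (B1 ⊗[k] (B2 ⊗[k] (B1 ⊗[k] (B2 ⊗[k] (B2 ⊗[k] (B1 ⊗[k] B2)))))))))))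
      ∘ₗ ((split2 hd.delta1) : (B1 ⊗[k] (B2 ⊗[k] (B1 ⊗[k] (B1 ⊗[k] (B2 ⊗[k] (B1 ⊗[k] (B2 ⊗[k] (B2 ⊗[k] (B1 ⊗[k] B2))))))))) →ₗ[k] (B1 ⊗[k] (B1 ⊗[k] (B2 ⊗[k] (B1 ⊗[k] (B1 ⊗[k] (B2 ⊗[k] (B1 ⊗[k] (B2 ⊗[k] (B2 ⊗[k] (B1 ⊗[k] B2)))))))))))
      ∘ₗ ((skp (skp (skp (skp (skp (skp (skp (split2 hd.coactL)))))))) : (B1 ⊗[k] (B2 ⊗[k] (B1 ⊗[k] (B1 ⊗[k] (B2 ⊗[k] (B1 ⊗[k] (B2 ⊗[k] (B1 ⊗[k] B2)))))))) →ₗ[k] (B1 ⊗[k] (B2 ⊗[k] (B1 ⊗[k] (B1 ⊗[k] (B2 ⊗[k] (B1 ⊗[k] (B2 ⊗[k] (B2 ⊗[k] (B1 ⊗[k] B2))))))))))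
      ∘ₗ ((skp (skp (skp (skp (skp swap2))))) : (B1 ⊗[k] (B2 ⊗[k] (B1 ⊗[k] (B1 ⊗[k] (B2 ⊗[k] (B2 ⊗[k] (B1 ⊗[k] (B1 ⊗[k] B2)))))))) →ₗ[k] (B1 ⊗[k] (B2 ⊗[k] (B1 ⊗[k] (B1 ⊗[k] (B2 ⊗[k] (B1 ⊗[k] (B2 ⊗[k] (B1 ⊗[k] B2)))))))))
      ∘ₗ ((skp (skp (skp swap2))) : (B1 ⊗[k] (B2 ⊗[k] (B1 ⊗[k] (B2 ⊗[k] (B1 ⊗[k] (B2 ⊗[k] (B1 ⊗[k] (B1 ⊗[k] B2)))))))) →ₗ[k] (B1 ⊗[k] (B2 ⊗[k] (B1 ⊗[k] (B1 ⊗[k] (B2 ⊗[k] (B2 ⊗[k] (B1 ⊗[k] (B1 ⊗[k] B2)))))))))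
      ∘ₗ ((skp (split2 hd.coactR)) : (B1 ⊗[k] (B2 ⊗[k] (B2 ⊗[k] (B1 ⊗[k] (B2 ⊗[k] (B1 ⊗[k] (B1 ⊗[k] B2))))))) →ₗ[k] (B1 ⊗[k] (B2 ⊗[k] (B1 ⊗[k] (B2 ⊗[k] (B1 ⊗[k] (B2 ⊗[k] (B1 ⊗[k] (B1 ⊗[k] B2)))))))))
      ∘ₗ ((skp (skp (skp (skp (skp (split2 hd.delta1)))))) : (B1 ⊗[k] (B2 ⊗[k] (B2 ⊗[k] (B1 ⊗[k] (B2 ⊗[k] (B1 ⊗[k] B2)))))) →ₗ[k] (B1 ⊗[k] (B2 ⊗[k] (B2 ⊗[k] (B1 ⊗[k] (B2 ⊗[k] (B1 ⊗[k] (B1 ⊗[k] B2))))))))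
      ∘ₗ ((skp (skp (skp swap2))) : (B1 ⊗[k] (B2 ⊗[k] (B2 ⊗[k] (B2 ⊗[k] (B1 ⊗[k] (B1 ⊗[k] B2)))))) →ₗ[k] (B1 ⊗[k] (B2 ⊗[k] (B2 ⊗[k] (B1 ⊗[k] (B2 ⊗[k] (B1 ⊗[k] B2)))))))
      ∘ₗ ((skp (split2 hd.delta2)) : (B1 ⊗[k] (B2 ⊗[k] (B2 ⊗[k] (B1 ⊗[k] (B1 ⊗[k] B2))))) →ₗ[k] (B1 ⊗[k] (B2 ⊗[k] (B2 ⊗[k] (B2 ⊗[k] (B1 ⊗[k] (B1 ⊗[k] B2)))))))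
      ∘ₗ ((skp (skp (skp (split2 hd.delta1)))) : (B1 ⊗[k] (B2 ⊗[k] (B2 ⊗[k] (B1 ⊗[k] B2)))) →ₗ[k] (B1 ⊗[k] (B2 ⊗[k] (B2 ⊗[k] (B1 ⊗[k] (B1 ⊗[k] B2))))))
      ∘ₗ ((skp (split2 hd.delta2)) : (B1 ⊗[k] (B2 ⊗[k] (B1 ⊗[k] B2))) →ₗ[k] (B1 ⊗[k] (B2 ⊗[k] (B2 ⊗[k] (B1 ⊗[k] B2)))))

end Derived

end CPB

namespace CPB


section Aux
variable {k : Type*} [CommRing k]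
variable {A B C D R R' : Type*}
  [AddCommMonoid A] [Module k A] [AddCommMonoid B] [Module k B]
  [AddCommMonoid C] [Module k C] [AddCommMonoid D] [Module k D]
  [AddCommMonoid R] [Module k R] [AddCommMonoid R'] [Module k R']

theorem skp_tmul (g : R →ₗ[k] R') (a : A) (r : R) : skp g (a ⊗ₜ[k] r) = a ⊗ₜ[k] g r := by
  simp [skp]

theorem pair2_tmul (op : (A ⊗[k] B) →ₗ[k] (C ⊗[k] D)) (a : A) (b : B) (r : R) :
    pair2 op (a ⊗ₜ[k] (b ⊗ₜ[k] r)) = TensorProduct.assoc k C D R (op (a ⊗ₜ[k] b) ⊗ₜ[k] r) := by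
  simp [pair2]

theorem merge2_tmul (m : (A ⊗[k] B) →ₗ[k] C) (a : A) (b : B) (r : R) :
    merge2 m (a ⊗ₜ[k] (b ⊗ₜ[k] r)) = m (a ⊗ₜ[k] b) ⊗ₜ[k] r := by
  simp [merge2]

theorem split2_tmul (d : A →ₗ[k] (C ⊗[k] D)) (a : A) (r : R) :
    split2 d (a ⊗ₜ[k] r) = TensorProduct.assoc k C D R (d a ⊗ₜ[k] r) := by
  simp [split2]

theorem skp2_assoc (g : R →ₗ[k] R') (t : A ⊗[k] B) (r : R) :
    skp (skp g) (TensorProduct.assoc k A B R (t ⊗ₜ[k] r)) =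
      TensorProduct.assoc k A B R' (t ⊗ₜ[k] g r) := by
  induction t using TensorProduct.induction_on with
  | zero => simp
  | add x y hx hy => simp only [TensorProduct.add_tmul, map_add, hx, hy]
  | tmul a b => simp [skp_tmul]

theorem swap2_tmul (a : A) (b : B) (r : R) :
    swap2 (a ⊗ₜ[k] (b ⊗ₜ[k] r)) = b ⊗ₜ[k] (a ⊗ₜ[k] r) := by
  simp [swap2, pair2]

/-- linear maps agreeing on pure tensors agree -/
theorem teq {f g : (A ⊗[k] B) →ₗ[k] C} (h : ∀ a b, f (a ⊗ₜ[k] b) = g (a ⊗ₜ[k] b))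
    (t : A ⊗[k] B) : f t = g t := by
  rw [TensorProduct.ext' h]

/-- Induction over a tensor whose zero and additivity steps are discharged automatically; what
remains is the case of a pure tensor. -/
theorem pure_ind {P : A ⊗[k] B → Prop} (pure : ∀ a b, P (a ⊗ₜ[k] b))
    (h0 : P 0 := by simp)
    (ha : ∀ x y, P x → P y → P (x + y) := by
      intro x y hx hy
      simp only [TensorProduct.add_tmul, TensorProduct.tmul_add, map_add, smul_add, add_smul,
        hx, hy]) (t : A ⊗[k] B) : P t :=
  t.induction_on h0 pure ha

end Aux

/-- a bialgebra admissible tuple -/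
structure BAT (k : Type*) [CommRing k] (B1 B2 : Type*)
    [AddCommMonoid B1] [Module k B1] [AddCommMonoid B2] [Module k B2] where
  d1 : ACData k B1
  d2 : ACData k B2
  h1 : d1.counit ∘ₗ d1.unit = LinearMap.id
  h2 : d2.counit ∘ₗ d2.unit = LinearMap.id
  phi12 : (B1 ⊗[k] B2) →ₗ[k] (B2 ⊗[k] B1)
  phi21 : (B2 ⊗[k] B1) →ₗ[k] (B1 ⊗[k] B2)
  hb : IsBialgebraMaps k (B1 ⊗[k] B2)
      (crossMul d1.mul d2.mul phi21) (crossUnit d1.unit d2.unit)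
      (crossComul d1.comul d2.comul phi12) (crossCounit d1.counit d2.counit)

namespace BAT
variable {k : Type*} [CommRing k] {B1 B2 : Type*}
    [AddCommMonoid B1] [Module k B1] [AddCommMonoid B2] [Module k B2] (X : BAT k B1 B2)

/-- unit element of the first factor -/
noncomputable def u1 : B1 := X.d1.unit 1
/-- unit element of the second factor -/
noncomputable def u2 : B2 := X.d2.unit 1
/-- product on the tensor product -/
noncomputable def m : ((B1 ⊗[k] B2) ⊗[k] (B1 ⊗[k] B2)) →ₗ[k] (B1 ⊗[k] B2) :=
  crossMul X.d1.mul X.d2.mul X.phi21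
/-- coproduct on the tensor product -/
noncomputable def D : (B1 ⊗[k] B2) →ₗ[k] ((B1 ⊗[k] B2) ⊗[k] (B1 ⊗[k] B2)) :=
  crossComul X.d1.comul X.d2.comul X.phi12
/-- first projection -/
noncomputable def p1 : (B1 ⊗[k] B2) →ₗ[k] B1 :=
  (TensorProduct.rid k B1).toLinearMap ∘ₗ TensorProduct.map LinearMap.id X.d2.counit
/-- second projection -/
noncomputable def p2 : (B1 ⊗[k] B2) →ₗ[k] B2 :=
  (TensorProduct.lid k B2).toLinearMap ∘ₗ TensorProduct.map X.d1.counit LinearMap.id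
/-- left action -/
noncomputable def actL : (B2 ⊗[k] B1) →ₗ[k] B1 := (TensorProduct.rid k B1).toLinearMap ∘ₗ
        TensorProduct.map LinearMap.id X.d2.counit ∘ₗ X.phi21
/-- right action -/
noncomputable def actR : (B2 ⊗[k] B1) →ₗ[k] B2 := (TensorProduct.lid k B2).toLinearMap ∘ₗ
        TensorProduct.map X.d1.counit LinearMap.id ∘ₗ X.phi21
/-- left coaction -/
noncomputable def coactL : B1 →ₗ[k] (B2 ⊗[k] B1) :=
  X.phi12 ∘ₗ TensorProduct.map LinearMap.id X.d2.unit ∘ₗ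
        (TensorProduct.rid k B1).symm.toLinearMap
/-- right coaction -/
noncomputable def coactR : B2 →ₗ[k] (B2 ⊗[k] B1) :=
  X.phi12 ∘ₗ TensorProduct.map X.d1.unit LinearMap.id ∘ₗ
        (TensorProduct.lid k B2).symm.toLinearMap

theorem unit1 (c : k) : X.d1.unit c = c • X.u1 := by
  rw [u1, ← map_smul]; simp
theorem unit2 (c : k) : X.d2.unit c = c • X.u2 := by
  rw [u2, ← map_smul]; simp
theorem eu1 : X.d1.counit X.u1 = 1 := LinearMap.congr_fun X.h1 1
theorem eu2 : X.d2.counit X.u2 = 1 := LinearMap.congr_fun X.h2 1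
theorem p1_tmul (a : B1) (b : B2) : X.p1 (a ⊗ₜ[k] b) = X.d2.counit b • a := by
  simp [p1]
theorem p2_tmul (a : B1) (b : B2) : X.p2 (a ⊗ₜ[k] b) = X.d1.counit a • b := by
  simp [p2]
theorem actL_eq (t : B2 ⊗[k] B1) : X.actL t = X.p1 (X.phi21 t) := rfl
theorem actR_eq (t : B2 ⊗[k] B1) : X.actR t = X.p2 (X.phi21 t) := rfl
theorem coactL_eq (a : B1) : X.coactL a = X.phi12 (a ⊗ₜ[k] X.u2) := by
  simp [coactL, u2]
theorem coactR_eq (b : B2) : X.coactR b = X.phi12 (X.u1 ⊗ₜ[k] b) := by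
  simp [coactR, u1]
theorem one_mul1 (a : B1) : X.d1.mul (X.u1 ⊗ₜ[k] a) = a := by
  simpa [u1] using LinearMap.congr_fun X.d1.alg.one_mul a
theorem mul_one1 (a : B1) : X.d1.mul (a ⊗ₜ[k] X.u1) = a := by
  simpa [u1] using LinearMap.congr_fun X.d1.alg.mul_one a
theorem one_mul2 (a : B2) : X.d2.mul (X.u2 ⊗ₜ[k] a) = a := by
  simpa [u2] using LinearMap.congr_fun X.d2.alg.one_mul a
theorem mul_one2 (a : B2) : X.d2.mul (a ⊗ₜ[k] X.u2) = a := by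
  simpa [u2] using LinearMap.congr_fun X.d2.alg.mul_one a
theorem counitl1 (a : B1) : TensorProduct.lid k B1
    (TensorProduct.map X.d1.counit LinearMap.id (X.d1.comul a)) = a := by
  simpa using LinearMap.congr_fun X.d1.coalg.counit_left a
theorem counitr1 (a : B1) : TensorProduct.rid k B1
    (TensorProduct.map LinearMap.id X.d1.counit (X.d1.comul a)) = a := by
  simpa using LinearMap.congr_fun X.d1.coalg.counit_right a
theorem counitl2 (a : B2) : TensorProduct.lid k B2
    (TensorProduct.map X.d2.counit LinearMap.id (X.d2.comul a)) = a := by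
  simpa using LinearMap.congr_fun X.d2.coalg.counit_left a
theorem counitr2 (a : B2) : TensorProduct.rid k B2
    (TensorProduct.map LinearMap.id X.d2.counit (X.d2.comul a)) = a := by
  simpa using LinearMap.congr_fun X.d2.coalg.counit_right a

/-- left multiplication on the first factor -/
noncomputable def L1 (a : B1) : B1 →ₗ[k] B1 := X.d1.mul ∘ₗ TensorProduct.mk k B1 B1 a
/-- right multiplication on the second factor -/
noncomputable def R2 (a : B2) : B2 →ₗ[k] B2 := X.d2.mul ∘ₗ (TensorProduct.mk k B2 B2).flip a
theorem L1_apply (a c : B1) : X.L1 a c = X.d1.mul (a ⊗ₜ[k] c) := rfl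
theorem R2_apply (a c : B2) : X.R2 a c = X.d2.mul (c ⊗ₜ[k] a) := rfl
theorem L1_one : X.L1 X.u1 = LinearMap.id := by
  ext c; simp [L1_apply, one_mul1]
theorem R2_one : X.R2 X.u2 = LinearMap.id := by
  ext c; simp [R2_apply, mul_one2]

theorem m_tmul (a c : B1) (b d : B2) : X.m ((a ⊗ₜ[k] b) ⊗ₜ[k] (c ⊗ₜ[k] d)) =
    TensorProduct.map (X.L1 a) (X.R2 d) (X.phi21 (b ⊗ₜ[k] c)) := by
  simp only [m, crossMul, LinearMap.comp_apply, LinearEquiv.coe_coe, TensorProduct.assoc_tmul,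
    skp_tmul, pair2_tmul]
  generalize X.phi21 (b ⊗ₜ[k] c) = t
  revert t; refine pure_ind fun x y => ?_
  simp [merge2_tmul, skp_tmul, L1_apply, R2_apply]

theorem unit_eq : crossUnit X.d1.unit X.d2.unit 1 = X.u1 ⊗ₜ[k] X.u2 := by
  simp [crossUnit, u1, u2]
theorem counit_tmul (a : B1) (b : B2) : crossCounit X.d1.counit X.d2.counit (a ⊗ₜ[k] b) =
    X.d1.counit a * X.d2.counit b := by
  simp [crossCounit]

theorem m_one (x : B1 ⊗[k] B2) : X.m (x ⊗ₜ[k] (X.u1 ⊗ₜ[k] X.u2)) = x := by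
  have := LinearMap.congr_fun X.hb.alg.mul_one x
  simpa [unit_eq, m] using this
theorem one_m (x : B1 ⊗[k] B2) : X.m ((X.u1 ⊗ₜ[k] X.u2) ⊗ₜ[k] x) = x := by
  have := LinearMap.congr_fun X.hb.alg.one_mul x
  simpa [unit_eq, m] using this

theorem phi21_one_left (a : B1) : X.phi21 (X.u2 ⊗ₜ[k] a) = a ⊗ₜ[k] X.u2 := by
  have := X.one_m (a ⊗ₜ[k] X.u2)
  simpa [m_tmul, L1_one, R2_one] using this
theorem phi21_one_right (b : B2) : X.phi21 (b ⊗ₜ[k] X.u1) = X.u1 ⊗ₜ[k] b := by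
  have := X.m_one (X.u1 ⊗ₜ[k] b)
  simpa [m_tmul, L1_one, R2_one] using this

theorem m21 (b : B2) (a : B1) : X.m ((X.u1 ⊗ₜ[k] b) ⊗ₜ[k] (a ⊗ₜ[k] X.u2)) =
    X.phi21 (b ⊗ₜ[k] a) := by
  simp [m_tmul, L1_one, R2_one]
theorem m1x (a c : B1) (d : B2) : X.m ((a ⊗ₜ[k] X.u2) ⊗ₜ[k] (c ⊗ₜ[k] d)) =
    X.d1.mul (a ⊗ₜ[k] c) ⊗ₜ[k] d := by
  simp [m_tmul, phi21_one_left, L1_apply, R2_apply, one_mul2]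
theorem mx2 (a : B1) (b d : B2) : X.m ((a ⊗ₜ[k] b) ⊗ₜ[k] (X.u1 ⊗ₜ[k] d)) =
    a ⊗ₜ[k] X.d2.mul (b ⊗ₜ[k] d) := by
  simp [m_tmul, phi21_one_right, L1_apply, R2_apply, mul_one1]

theorem counit_m (x y : B1 ⊗[k] B2) : crossCounit X.d1.counit X.d2.counit (X.m (x ⊗ₜ[k] y)) =
    crossCounit X.d1.counit X.d2.counit x * crossCounit X.d1.counit X.d2.counit y := by
  have := LinearMap.congr_fun X.hb.counit_mul (x ⊗ₜ[k] y)
  simpa [m] using this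
theorem eps1_mul (a c : B1) : X.d1.counit (X.d1.mul (a ⊗ₜ[k] c)) =
    X.d1.counit a * X.d1.counit c := by
  have := X.counit_m (a ⊗ₜ[k] X.u2) (c ⊗ₜ[k] X.u2)
  simpa [m1x, counit_tmul, eu2] using this
theorem eps2_mul (a c : B2) : X.d2.counit (X.d2.mul (a ⊗ₜ[k] c)) =
    X.d2.counit a * X.d2.counit c := by
  have := X.counit_m (X.u1 ⊗ₜ[k] a) (X.u1 ⊗ₜ[k] c)
  simpa [mx2, counit_tmul, eu1] using this
theorem counit_phi21 (b : B2) (a : B1) : crossCounit X.d1.counit X.d2.counit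
    (X.phi21 (b ⊗ₜ[k] a)) = X.d2.counit b * X.d1.counit a := by
  have := X.counit_m (X.u1 ⊗ₜ[k] b) (a ⊗ₜ[k] X.u2)
  simpa [m21, counit_tmul, eu1, eu2] using this
theorem eps1_p1 (x : B1 ⊗[k] B2) : X.d1.counit (X.p1 x) =
    crossCounit X.d1.counit X.d2.counit x := by
  revert x; refine pure_ind fun x y => ?_
  simp [p1_tmul, counit_tmul, mul_comm]
theorem eps2_p2 (x : B1 ⊗[k] B2) : X.d2.counit (X.p2 x) =
    crossCounit X.d1.counit X.d2.counit x := by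
  revert x; refine pure_ind fun x y => ?_
  simp [p2_tmul, counit_tmul]

theorem p1_m (a c : B1) (b d : B2) : X.p1 (X.m ((a ⊗ₜ[k] b) ⊗ₜ[k] (c ⊗ₜ[k] d))) =
    X.d2.counit d • X.d1.mul (a ⊗ₜ[k] X.actL (b ⊗ₜ[k] c)) := by
  simp only [m_tmul, actL_eq]
  generalize X.phi21 (b ⊗ₜ[k] c) = t
  revert t; refine pure_ind fun x y => ?_
  simp [p1_tmul, L1_apply, R2_apply, eps2_mul, smul_smul, mul_comm]
theorem p2_m (a c : B1) (b d : B2) : X.p2 (X.m ((a ⊗ₜ[k] b) ⊗ₜ[k] (c ⊗ₜ[k] d))) =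
    X.d1.counit a • X.d2.mul (X.actR (b ⊗ₜ[k] c) ⊗ₜ[k] d) := by
  simp only [m_tmul, actR_eq]
  generalize X.phi21 (b ⊗ₜ[k] c) = t
  revert t; refine pure_ind fun x y => ?_
  simp [p2_tmul, L1_apply, R2_apply, eps1_mul, mul_smul, ← TensorProduct.smul_tmul']

/-! Units and the coproduct -/

theorem D_one : X.D (X.u1 ⊗ₜ[k] X.u2) = (X.u1 ⊗ₜ[k] X.u2) ⊗ₜ[k] (X.u1 ⊗ₜ[k] X.u2) := by
  have := LinearMap.congr_fun X.hb.comul_unit 1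
  simpa [unit_eq, D] using this

theorem D_tmul (a : B1) (b : B2) : X.D (a ⊗ₜ[k] b) =
    (TensorProduct.assoc k B1 B2 (B1 ⊗[k] B2)).symm
      (skp (pair2 X.phi12) (TensorProduct.assoc k B1 B1 (B2 ⊗[k] B2)
        (X.d1.comul a ⊗ₜ[k] X.d2.comul b))) := by
  simp only [D, crossComul, LinearMap.comp_apply, LinearEquiv.coe_coe, split2_tmul]
  congr 2
  generalize X.d1.comul a = t
  revert t; refine pure_ind fun x y => ?_
  simp [skp_tmul]

/-- coproduct form -/
noncomputable def W (f : (B1 ⊗[k] B2) →ₗ[k] (B2 ⊗[k] B1)) :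
    ((B1 ⊗[k] B1) ⊗[k] (B2 ⊗[k] B2)) →ₗ[k] ((B1 ⊗[k] B2) ⊗[k] (B1 ⊗[k] B2)) :=
  (TensorProduct.assoc k B1 B2 (B1 ⊗[k] B2)).symm.toLinearMap ∘ₗ skp (pair2 f) ∘ₗ
    (TensorProduct.assoc k B1 B1 (B2 ⊗[k] B2)).toLinearMap

theorem D_tmul' (a : B1) (b : B2) : X.D (a ⊗ₜ[k] b) =
    W X.phi12 (X.d1.comul a ⊗ₜ[k] X.d2.comul b) := X.D_tmul a b

/-- insertion of two outer legs -/
noncomputable def Ins (a : B1) (b : B2) : (B2 ⊗[k] B1) →ₗ[k] ((B1 ⊗[k] B2) ⊗[k] (B1 ⊗[k] B2)) :=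
  TensorProduct.map (TensorProduct.mk k B1 B2 a) ((TensorProduct.mk k B1 B2).flip b)
theorem Ins_tmul (a c : B1) (b d : B2) : Ins (k := k) a b (d ⊗ₜ[k] c) =
    (a ⊗ₜ[k] d) ⊗ₜ[k] (c ⊗ₜ[k] b) := by simp [Ins]
theorem W_tmul (f : (B1 ⊗[k] B2) →ₗ[k] (B2 ⊗[k] B1)) (a c : B1) (b d : B2) :
    W f ((a ⊗ₜ[k] c) ⊗ₜ[k] (b ⊗ₜ[k] d)) = Ins a d (f (c ⊗ₜ[k] b)) := by
  simp only [W, LinearMap.comp_apply, LinearEquiv.coe_coe, TensorProduct.assoc_tmul,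
    skp_tmul, pair2_tmul]
  generalize f (c ⊗ₜ[k] b) = t
  revert t; refine pure_ind fun x y => ?_
  simp [Ins_tmul]


/-- counit of the second factor applied to the first leg -/
noncomputable def q1 : (B2 ⊗[k] B1) →ₗ[k] B1 :=
  (TensorProduct.lid k B1).toLinearMap ∘ₗ TensorProduct.map X.d2.counit LinearMap.id
/-- counit of the first factor applied to the second leg -/
noncomputable def q2 : (B2 ⊗[k] B1) →ₗ[k] B2 :=
  (TensorProduct.rid k B2).toLinearMap ∘ₗ TensorProduct.map LinearMap.id X.d1.counit
theorem q1_tmul (a : B1) (b : B2) : X.q1 (b ⊗ₜ[k] a) = X.d2.counit b • a := by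
  simp [q1]
theorem q2_tmul (a : B1) (b : B2) : X.q2 (b ⊗ₜ[k] a) = X.d1.counit a • b := by
  simp [q2]

/-- `ε ⊗ id` on the first factor -/
noncomputable def l1 : (B1 ⊗[k] B1) →ₗ[k] B1 :=
  (TensorProduct.lid k B1).toLinearMap ∘ₗ TensorProduct.map X.d1.counit LinearMap.id
/-- `id ⊗ ε` on the first factor -/
noncomputable def r1 : (B1 ⊗[k] B1) →ₗ[k] B1 :=
  (TensorProduct.rid k B1).toLinearMap ∘ₗ TensorProduct.map LinearMap.id X.d1.counit
/-- `ε ⊗ id` on the second factor -/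
noncomputable def l2 : (B2 ⊗[k] B2) →ₗ[k] B2 :=
  (TensorProduct.lid k B2).toLinearMap ∘ₗ TensorProduct.map X.d2.counit LinearMap.id
/-- `id ⊗ ε` on the second factor -/
noncomputable def r2 : (B2 ⊗[k] B2) →ₗ[k] B2 :=
  (TensorProduct.rid k B2).toLinearMap ∘ₗ TensorProduct.map LinearMap.id X.d2.counit
theorem l1_tmul (a c : B1) : X.l1 (a ⊗ₜ[k] c) = X.d1.counit a • c := by simp [l1]
theorem r1_tmul (a c : B1) : X.r1 (a ⊗ₜ[k] c) = X.d1.counit c • a := by simp [r1]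
theorem l2_tmul (a c : B2) : X.l2 (a ⊗ₜ[k] c) = X.d2.counit a • c := by simp [l2]
theorem r2_tmul (a c : B2) : X.r2 (a ⊗ₜ[k] c) = X.d2.counit c • a := by simp [r2]
theorem l1_D (a : B1) : X.l1 (X.d1.comul a) = a := X.counitl1 a
theorem r1_D (a : B1) : X.r1 (X.d1.comul a) = a := X.counitr1 a
theorem l2_D (a : B2) : X.l2 (X.d2.comul a) = a := X.counitl2 a
theorem r2_D (a : B2) : X.r2 (X.d2.comul a) = a := X.counitr2 a

theorem counit_left_W (f : (B1 ⊗[k] B2) →ₗ[k] (B2 ⊗[k] B1)) :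
    X.p1 ∘ₗ (TensorProduct.lid k _).toLinearMap ∘ₗ
      TensorProduct.map (crossCounit X.d1.counit X.d2.counit) LinearMap.id ∘ₗ W f =
    X.q1 ∘ₗ f ∘ₗ TensorProduct.map X.l1 X.r2 := by
  refine TensorProduct.ext_fourfold' fun a c b d => ?_
  simp only [LinearMap.comp_apply, W_tmul, TensorProduct.map_tmul, l1_tmul, r2_tmul,
    ← TensorProduct.smul_tmul', TensorProduct.tmul_smul, map_smul, LinearEquiv.coe_coe]
  generalize f (c ⊗ₜ[k] b) = t
  revert t; refine pure_ind fun x y => ?_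
  simp only [Ins_tmul, TensorProduct.map_tmul, counit_tmul, TensorProduct.lid_tmul, q1_tmul,
      map_smul, p1_tmul, LinearMap.id_apply, smul_smul]
  congr 1; ring

theorem counit_right_W (f : (B1 ⊗[k] B2) →ₗ[k] (B2 ⊗[k] B1)) :
    X.p2 ∘ₗ (TensorProduct.rid k _).toLinearMap ∘ₗ
      TensorProduct.map LinearMap.id (crossCounit X.d1.counit X.d2.counit) ∘ₗ W f =
    X.q2 ∘ₗ f ∘ₗ TensorProduct.map X.l1 X.r2 := by
  refine TensorProduct.ext_fourfold' fun a c b d => ?_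
  simp only [LinearMap.comp_apply, W_tmul, TensorProduct.map_tmul, l1_tmul, r2_tmul,
    ← TensorProduct.smul_tmul', TensorProduct.tmul_smul, map_smul, LinearEquiv.coe_coe]
  generalize f (c ⊗ₜ[k] b) = t
  revert t; refine pure_ind fun x y => ?_
  simp only [Ins_tmul, TensorProduct.map_tmul, counit_tmul, TensorProduct.rid_tmul, q2_tmul,
      map_smul, p2_tmul, LinearMap.id_apply, smul_smul]
  congr 1; ring

theorem q1_phi12 (a : B1) (b : B2) : X.q1 (X.phi12 (a ⊗ₜ[k] b)) = X.d2.counit b • a := by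
  have h := LinearMap.congr_fun (X.counit_left_W X.phi12) (X.d1.comul a ⊗ₜ[k] X.d2.comul b)
  have hh := LinearMap.congr_fun X.hb.coalg.counit_left (a ⊗ₜ[k] b)
  simp only [LinearMap.comp_apply, ← D_tmul', TensorProduct.map_tmul, l1_D, r2_D] at h
  rw [← h]
  have h2 := congrArg X.p1 hh
  rw [LinearMap.id_apply, p1_tmul] at h2
  exact h2

theorem q2_phi12 (a : B1) (b : B2) : X.q2 (X.phi12 (a ⊗ₜ[k] b)) = X.d1.counit a • b := by
  have h := LinearMap.congr_fun (X.counit_right_W X.phi12) (X.d1.comul a ⊗ₜ[k] X.d2.comul b)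
  have hh := LinearMap.congr_fun X.hb.coalg.counit_right (a ⊗ₜ[k] b)
  simp only [LinearMap.comp_apply, ← D_tmul', TensorProduct.map_tmul, l1_D, r2_D] at h
  rw [← h]
  have h2 := congrArg X.p2 hh
  rw [LinearMap.id_apply, p2_tmul] at h2
  exact h2

theorem p1p1_Ins (a : B1) (d : B2) (t : B2 ⊗[k] B1) : TensorProduct.map X.p1 X.p1 (Ins a d t) =
    X.d2.counit d • (a ⊗ₜ[k] X.q1 t) := by
  revert t; refine pure_ind fun x y => ?_
  simp [Ins_tmul, p1_tmul, q1_tmul, TensorProduct.smul_tmul', smul_smul]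
theorem p2p2_Ins (a : B1) (d : B2) (t : B2 ⊗[k] B1) : TensorProduct.map X.p2 X.p2 (Ins a d t) =
    X.d1.counit a • (X.q2 t ⊗ₜ[k] d) := by
  revert t; refine pure_ind fun x y => ?_
  simp only [Ins_tmul, p2_tmul, q2_tmul, TensorProduct.map_tmul, TensorProduct.tmul_smul,
      ← TensorProduct.smul_tmul', smul_smul, mul_comm]
theorem p2p1_Ins (a : B1) (d : B2) (t : B2 ⊗[k] B1) : TensorProduct.map X.p2 X.p1 (Ins a d t) =
    (X.d1.counit a * X.d2.counit d) • t := by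
  revert t; refine pure_ind fun x y => ?_
  simp only [Ins_tmul, p2_tmul, p1_tmul, TensorProduct.map_tmul, TensorProduct.tmul_smul,
      ← TensorProduct.smul_tmul', smul_smul, mul_comm]
theorem p1p2_Ins (a : B1) (d : B2) (t : B2 ⊗[k] B1) : TensorProduct.map X.p1 X.p2 (Ins a d t) =
    (X.d1.counit (X.q1 t)) • (a ⊗ₜ[k] d) := by
  revert t; refine pure_ind fun x y => ?_
  simp only [Ins_tmul, p2_tmul, p1_tmul, q1_tmul, TensorProduct.map_tmul,
      TensorProduct.tmul_smul, map_smul, smul_eq_mul,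
      ← TensorProduct.smul_tmul', smul_smul, mul_comm]

theorem p1p1_W : TensorProduct.map X.p1 X.p1 ∘ₗ W X.phi12 =
    (TensorProduct.rid k _).toLinearMap ∘ₗ
      TensorProduct.map LinearMap.id (X.d2.counit ∘ₗ X.l2) := by
  refine TensorProduct.ext_fourfold' fun a c b d => ?_
  simp [W_tmul, p1p1_Ins, q1_phi12, l2_tmul, smul_smul, mul_comm]
theorem p2p2_W : TensorProduct.map X.p2 X.p2 ∘ₗ W X.phi12 =
    (TensorProduct.lid k _).toLinearMap ∘ₗ
      TensorProduct.map (X.d1.counit ∘ₗ X.l1) LinearMap.id := by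
  refine TensorProduct.ext_fourfold' fun a c b d => ?_
  simp [W_tmul, p2p2_Ins, q2_phi12, l1_tmul, ← TensorProduct.smul_tmul', smul_smul]
theorem p2p1_W : TensorProduct.map X.p2 X.p1 ∘ₗ W X.phi12 =
    X.phi12 ∘ₗ TensorProduct.map X.l1 X.r2 := by
  refine TensorProduct.ext_fourfold' fun a c b d => ?_
  simp [W_tmul, p2p1_Ins, l1_tmul, r2_tmul, ← TensorProduct.smul_tmul', smul_smul, mul_comm]
theorem p1p2_W : TensorProduct.map X.p1 X.p2 ∘ₗ W X.phi12 =
    TensorProduct.map X.r1 X.l2 := by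
  refine TensorProduct.ext_fourfold' fun a c b d => ?_
  simp [W_tmul, p1p2_Ins, q1_phi12, r1_tmul, l2_tmul, ← TensorProduct.smul_tmul', smul_smul,
    mul_comm]

theorem p1p1_D (x : B1 ⊗[k] B2) : TensorProduct.map X.p1 X.p1 (X.D x) = X.d1.comul (X.p1 x) := by
  refine teq (f := TensorProduct.map X.p1 X.p1 ∘ₗ X.D) (g := X.d1.comul ∘ₗ X.p1)
    (fun a b => ?_) x
  have h := LinearMap.congr_fun X.p1p1_W (X.d1.comul a ⊗ₜ[k] X.d2.comul b)
  simpa [← D_tmul', l2_D, p1_tmul] using h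
theorem p2p2_D (x : B1 ⊗[k] B2) : TensorProduct.map X.p2 X.p2 (X.D x) = X.d2.comul (X.p2 x) := by
  refine teq (f := TensorProduct.map X.p2 X.p2 ∘ₗ X.D) (g := X.d2.comul ∘ₗ X.p2)
    (fun a b => ?_) x
  have h := LinearMap.congr_fun X.p2p2_W (X.d1.comul a ⊗ₜ[k] X.d2.comul b)
  simpa [← D_tmul', l1_D, p2_tmul] using h
theorem p2p1_D (x : B1 ⊗[k] B2) : TensorProduct.map X.p2 X.p1 (X.D x) = X.phi12 x := by
  refine teq (f := TensorProduct.map X.p2 X.p1 ∘ₗ X.D) (g := X.phi12)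
    (fun a b => ?_) x
  have h := LinearMap.congr_fun X.p2p1_W (X.d1.comul a ⊗ₜ[k] X.d2.comul b)
  simpa [← D_tmul', l1_D, r2_D] using h
theorem p1p2_D (x : B1 ⊗[k] B2) : TensorProduct.map X.p1 X.p2 (X.D x) = x := by
  refine teq (f := TensorProduct.map X.p1 X.p2 ∘ₗ X.D) (g := LinearMap.id)
    (fun a b => ?_) x
  have h := LinearMap.congr_fun X.p1p2_W (X.d1.comul a ⊗ₜ[k] X.d2.comul b)
  simpa [← D_tmul', r1_D, l2_D] using h

theorem comul_u1 : X.d1.comul X.u1 = X.u1 ⊗ₜ[k] X.u1 := by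
  have h := X.p1p1_D (X.u1 ⊗ₜ[k] X.u2)
  simpa [D_one, p1_tmul, eu2] using h.symm
theorem comul_u2 : X.d2.comul X.u2 = X.u2 ⊗ₜ[k] X.u2 := by
  have h := X.p2p2_D (X.u1 ⊗ₜ[k] X.u2)
  simpa [D_one, p2_tmul, eu1] using h.symm
theorem phi12_one : X.phi12 (X.u1 ⊗ₜ[k] X.u2) = X.u2 ⊗ₜ[k] X.u1 := by
  have h := X.p2p1_D (X.u1 ⊗ₜ[k] X.u2)
  simpa [D_one, p1_tmul, p2_tmul, eu1, eu2] using h.symm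

theorem q1_coactL (a : B1) : X.q1 (X.coactL a) = a := by
  simp [coactL_eq, q1_phi12, eu2]
theorem q2_coactL (a : B1) : X.q2 (X.coactL a) = X.d1.counit a • X.u2 := by
  simp [coactL_eq, q2_phi12]
theorem q1_coactR (b : B2) : X.q1 (X.coactR b) = X.d2.counit b • X.u1 := by
  simp [coactR_eq, q1_phi12]
theorem q2_coactR (b : B2) : X.q2 (X.coactR b) = b := by
  simp [coactR_eq, q2_phi12, eu1]
theorem actL_u2 (a : B1) : X.actL (X.u2 ⊗ₜ[k] a) = a := by
  simp [actL_eq, phi21_one_left, p1_tmul, eu2]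
theorem actL_u1 (b : B2) : X.actL (b ⊗ₜ[k] X.u1) = X.d2.counit b • X.u1 := by
  simp [actL_eq, phi21_one_right, p1_tmul]
theorem actR_u2 (a : B1) : X.actR (X.u2 ⊗ₜ[k] a) = X.d1.counit a • X.u2 := by
  simp [actR_eq, phi21_one_left, p2_tmul]
theorem actR_u1 (b : B2) : X.actR (b ⊗ₜ[k] X.u1) = b := by
  simp [actR_eq, phi21_one_right, p2_tmul, eu1]

theorem DM {P Q : Type*} [AddCommMonoid P] [Module k P] [AddCommMonoid Q] [Module k Q]
    (p : (B1 ⊗[k] B2) →ₗ[k] P) (q : (B1 ⊗[k] B2) →ₗ[k] Q) (x y : B1 ⊗[k] B2) :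
    TensorProduct.map p q (X.D (X.m (x ⊗ₜ[k] y))) =
    TensorProduct.map (p ∘ₗ X.m) (q ∘ₗ X.m)
      (TensorProduct.tensorTensorTensorComm k _ _ _ _ (X.D x ⊗ₜ[k] X.D y)) := by
  have h := LinearMap.congr_fun X.hb.comul_mul (x ⊗ₜ[k] y)
  have hh := congrArg (TensorProduct.map p q) h
  rw [TensorProduct.map_comp]
  exact hh

theorem CO {P Q R : Type*} [AddCommMonoid P] [Module k P] [AddCommMonoid Q] [Module k Q]
    [AddCommMonoid R] [Module k R]
    (p : (B1 ⊗[k] B2) →ₗ[k] P) (q : (B1 ⊗[k] B2) →ₗ[k] Q) (r : (B1 ⊗[k] B2) →ₗ[k] R)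
    (x : B1 ⊗[k] B2) :
    TensorProduct.assoc k P Q R
      (TensorProduct.map (TensorProduct.map p q ∘ₗ X.D) r (X.D x)) =
    TensorProduct.map p (TensorProduct.map q r ∘ₗ X.D) (X.D x) := by
  have h := LinearMap.congr_fun X.hb.coalg.coassoc x
  have hh := congrArg (TensorProduct.map p (TensorProduct.map q r)) h
  have e1 : TensorProduct.map p (TensorProduct.map q r ∘ₗ X.D) (X.D x) =
    TensorProduct.map p (TensorProduct.map q r) (TensorProduct.map LinearMap.id X.D (X.D x)) := by
    generalize X.D x = w
    conv_rhs => rw [← LinearMap.comp_apply, ← TensorProduct.map_comp, LinearMap.comp_id]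
  have e2 : TensorProduct.map (TensorProduct.map p q ∘ₗ X.D) r (X.D x) =
    TensorProduct.map (TensorProduct.map p q) r (TensorProduct.map X.D LinearMap.id (X.D x)) := by
    generalize X.D x = w
    conv_rhs => rw [← LinearMap.comp_apply, ← TensorProduct.map_comp, LinearMap.comp_id]
  have e3 : ∀ w, TensorProduct.assoc k P Q R (TensorProduct.map (TensorProduct.map p q) r w) =
      TensorProduct.map p (TensorProduct.map q r) (TensorProduct.assoc k _ _ _ w) := by
    intro w
    rw [TensorProduct.map_map_assoc]
  rw [e1, e2, e3]
  exact hh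

theorem AS (x y z : B1 ⊗[k] B2) :
    X.m (X.m (x ⊗ₜ[k] y) ⊗ₜ[k] z) = X.m (x ⊗ₜ[k] X.m (y ⊗ₜ[k] z)) := by
  simpa [m] using LinearMap.congr_fun X.hb.alg.mul_assoc ((x ⊗ₜ[k] y) ⊗ₜ[k] z)

theorem D_i1 (a : B1) : X.D (a ⊗ₜ[k] X.u2) = W X.phi12 (X.d1.comul a ⊗ₜ[k] (X.u2 ⊗ₜ[k] X.u2)) := by
  rw [D_tmul', comul_u2]
theorem D_i2 (b : B2) : X.D (X.u1 ⊗ₜ[k] b) = W X.phi12 ((X.u1 ⊗ₜ[k] X.u1) ⊗ₜ[k] X.d2.comul b) := by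
  rw [D_tmul', comul_u1]


/-! ### Verification of the laws

`X.Sat P` says that the twelve structure maps of the tuple satisfy the law `P`.
Every law below is obtained by one scheme. Let `p₁ = id ⊗ ε₂` and `p₂ = ε₁ ⊗ id` be the two
projections of the cross product. Multiplicativity of the coproduct, evaluated on products of
the embedded factors and then projected with `pᵢ ⊗ pⱼ`, produces the compatibility laws between
algebra and coalgebra structures; projected coassociativity produces the comodule laws, and
projected associativity the module laws. Once a law has been rewritten in this form, all
coproducts and coactions involved are replaced by arbitrary tensors, linearity reduces the claim
to pure tensors, and superfluous scalars are removed by the counit identities that were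
substituted beforehand (for example `a = q₁ (ν_l a)` just before `ν_l a` is generalized). -/

/-- the structure maps of the tuple satisfy the given law -/
def Sat (P : ((B1 ⊗[k] B1) →ₗ[k] B1) → (k →ₗ[k] B1) → (B1 →ₗ[k] (B1 ⊗[k] B1)) → (B1 →ₗ[k] k) →
    ((B2 ⊗[k] B2) →ₗ[k] B2) → (k →ₗ[k] B2) → (B2 →ₗ[k] (B2 ⊗[k] B2)) → (B2 →ₗ[k] k) →
    ((B2 ⊗[k] B1) →ₗ[k] B1) → (B1 →ₗ[k] (B2 ⊗[k] B1)) →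
    ((B2 ⊗[k] B1) →ₗ[k] B2) → (B2 →ₗ[k] (B2 ⊗[k] B1)) → Prop) : Prop :=
  P X.d1.mul X.d1.unit X.d1.comul X.d1.counit X.d2.mul X.d2.unit X.d2.comul X.d2.counit
    X.actL X.coactL X.actR X.coactR

open TensorProduct (add_tmul tmul_add assoc_tmul)

attribute [local simp] skp_tmul merge2_tmul swap2_tmul split2_tmul skp2_assoc Ins_tmul p1_m p2_m
  p1_tmul p2_tmul q1_tmul q2_tmul l1_tmul l2_tmul r1_tmul r2_tmul actL_u1 actL_u2 actR_u1 actR_u2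
  one_mul1 mul_one1 one_mul2 mul_one2 eu1 eu2

/-- The map `φ₂₁` is recovered from the two actions: apply `p₁ ⊗ p₂` to the coproduct of the
product of `1 ⊗ b` and `a ⊗ 1`. -/
theorem phi21_mp (b : B2) (a : B1) : mpPhi21 X.d1.comul X.d2.comul X.actL X.actR (b ⊗ₜ[k] a) = X.phi21 (b ⊗ₜ[k] a) := by
  rw [← X.p1p2_D (X.phi21 (b ⊗ₜ[k] a)), ← m21, DM, D_i1, D_i2, mpPhi21]
  simp only [LinearMap.comp_apply, split2_tmul, skp2_assoc]
  generalize X.d1.comul a = s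
  generalize X.d2.comul b = t
  revert t; refine pure_ind fun b1 b2 => ?_
  revert s; refine pure_ind fun a1 a2 => ?_
  simp only [split2_tmul, skp2_assoc, skp_tmul, merge2_tmul, swap2_tmul, W_tmul, ← coactL_eq, ← coactR_eq, assoc_tmul]
  have hl := X.q1_coactL a2
  generalize X.coactL a2 = l at hl ⊢
  subst hl
  have hr := X.q2_coactR b1
  generalize X.coactR b1 = r at hr ⊢
  subst hr
  revert l; refine pure_ind fun b3 a3 => ?_
  revert r; refine pure_ind fun b4 a4 => ?_
  simp [← TensorProduct.smul_tmul', smul_smul, mul_comm]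

/-- The map `φ₁₂` is recovered from the two coactions: write `a ⊗ b` as a product and apply
`p₂ ⊗ p₁` to its coproduct. -/
theorem phi12_mp (a : B1) (b : B2) : mpPhi12 X.d1.mul X.d2.mul X.coactL X.coactR (a ⊗ₜ[k] b) = X.phi12 (a ⊗ₜ[k] b) := by
  have e : a ⊗ₜ[k] b = X.m ((a ⊗ₜ[k] X.u2) ⊗ₜ[k] (X.u1 ⊗ₜ[k] b)) := by rw [m1x, mul_one1]
  rw [← X.p2p1_D (a ⊗ₜ[k] b), e, DM, ← e, D_i1, D_i2, mpPhi12]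
  clear e
  simp only [LinearMap.comp_apply, split2_tmul, skp2_assoc]
  have hs := X.l1_D a
  generalize X.d1.comul a = s at hs ⊢
  subst hs
  have ht := X.r2_D b
  generalize X.d2.comul b = t at ht ⊢
  subst ht
  revert t; refine pure_ind fun b1 b2 => ?_
  revert s; refine pure_ind fun a1 a2 => ?_
  simp only [split2_tmul, skp2_assoc, skp_tmul, merge2_tmul, swap2_tmul, W_tmul, ← coactL_eq, ← coactR_eq, assoc_tmul]
  simp only [l1_tmul, r2_tmul, map_smul, TensorProduct.tmul_smul, ← TensorProduct.smul_tmul', skp_tmul]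
  generalize X.coactL a2 = l
  generalize X.coactR b1 = r
  revert l; refine pure_ind fun b3 a3 => ?_
  simp only [assoc_tmul, skp_tmul]
  revert r; refine pure_ind fun b4 a4 => ?_
  simp [← TensorProduct.smul_tmul', smul_smul, mul_comm]

/-- The left action is compatible with `Δ₁` up to the left coaction. -/
theorem X_modCoalg2 : X.Sat (ax_modCoalg2 k B1 B2) := by
  unfold Sat ax_modCoalg2
  refine TensorProduct.ext' fun b a => ?_
  simp only [LinearMap.comp_apply, split2_tmul, skp2_assoc]
  rw [actL_eq (X := X) (b ⊗ₜ[k] a), ← p1p1_D]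
  rw [← m21, DM, D_i1, D_i2]
  generalize X.d1.comul a = s
  generalize X.d2.comul b = t
  revert t; refine pure_ind fun b1 b2 => ?_
  revert s; refine pure_ind fun a1 a2 => ?_
  simp only [split2_tmul, skp2_assoc, skp_tmul, merge2_tmul, swap2_tmul, W_tmul, ← coactL_eq, ← coactR_eq, assoc_tmul]
  have hl := X.q1_coactL a2
  generalize X.coactL a2 = l at hl ⊢
  subst hl
  generalize X.coactR b1 = r
  revert l; refine pure_ind fun b3 a3 => ?_
  revert r; refine pure_ind fun b4 a4 => ?_
  simp [← TensorProduct.smul_tmul', smul_smul, mul_comm]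

/-- Mirror image for the right action and `Δ₂`. -/
theorem X_modCoalg1 : X.Sat (ax_modCoalg1 k B1 B2) := by
  unfold Sat ax_modCoalg1
  refine TensorProduct.ext' fun b a => ?_
  simp only [LinearMap.comp_apply, split2_tmul, skp2_assoc]
  rw [actR_eq (X := X) (b ⊗ₜ[k] a), ← p2p2_D]
  rw [← m21, DM, D_i1, D_i2]
  generalize X.d1.comul a = s
  generalize X.d2.comul b = t
  revert t; refine pure_ind fun b1 b2 => ?_
  revert s; refine pure_ind fun a1 a2 => ?_
  simp only [split2_tmul, skp2_assoc, skp_tmul, merge2_tmul, swap2_tmul, W_tmul, ← coactL_eq, ← coactR_eq, assoc_tmul]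
  generalize X.coactL a2 = l
  have hr := X.q2_coactR b1
  generalize X.coactR b1 = r at hr ⊢
  subst hr
  revert l; refine pure_ind fun b3 a3 => ?_
  revert r; refine pure_ind fun b4 a4 => ?_
  simp [← TensorProduct.smul_tmul', smul_smul, mul_comm]

/-- Here both sides equal the mixed projection of the coproduct of `φ₂₁ (b ⊗ a)`, by the two
reconstruction formulas above. -/
theorem X_modComod : X.Sat (ax_modComod k B1 B2) := by
  unfold Sat ax_modComod
  refine TensorProduct.ext' fun b a => ?_
  have e1 : mpPhi12 X.d1.mul X.d2.mul X.coactL X.coactR = X.phi12 := TensorProduct.ext' X.phi12_mp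
  have e2 : mpPhi21 X.d1.comul X.d2.comul X.actL X.actR (b ⊗ₜ[k] a) = X.phi21 (b ⊗ₜ[k] a) := X.phi21_mp b a
  change mpPhi12 X.d1.mul X.d2.mul X.coactL X.coactR (mpPhi21 X.d1.comul X.d2.comul X.actL X.actR (b ⊗ₜ[k] a)) = _
  rw [e1, e2, ← p2p1_D, ← m21, DM, D_i1, D_i2]
  simp only [LinearMap.comp_apply, split2_tmul, skp2_assoc]
  generalize X.d1.comul a = s
  generalize X.d2.comul b = t
  revert t; refine pure_ind fun b1 b2 => ?_
  revert s; refine pure_ind fun a1 a2 => ?_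
  simp only [split2_tmul, skp2_assoc, skp_tmul, merge2_tmul, swap2_tmul, W_tmul, ← coactL_eq, ← coactR_eq, assoc_tmul]
  generalize X.coactR b1 = r
  revert r; refine pure_ind fun b4 a4 => ?_
  simp only [split2_tmul, skp2_assoc, skp_tmul, merge2_tmul, swap2_tmul, W_tmul, ← coactL_eq, ← coactR_eq, assoc_tmul]
  generalize X.coactL a2 = l
  revert l; refine pure_ind fun b3 a3 => ?_
  simp [← TensorProduct.smul_tmul', smul_smul, mul_comm]

/-- Coproduct of a product inside `B₁`, seen through `p₁ ⊗ p₁`. -/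
theorem X_algCoalg1 : X.Sat (ax_algCoalg1 k B1 B2) := by
  unfold Sat ax_algCoalg1
  refine TensorProduct.ext' fun a c => ?_
  have e := X.p1p1_D (X.m ((a ⊗ₜ[k] X.u2) ⊗ₜ[k] (c ⊗ₜ[k] X.u2)))
  rw [DM, D_i1, D_i1, m1x, p1_tmul, eu2, one_smul] at e
  simp only [LinearMap.comp_apply, split2_tmul, skp2_assoc, skp_tmul]
  rw [← e]
  clear e
  generalize X.d1.comul a = s
  generalize X.d1.comul c = t
  revert s; refine pure_ind fun a1 a2 => ?_
  revert t; refine pure_ind fun c1 c2 => ?_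
  simp only [split2_tmul, skp2_assoc, skp_tmul, merge2_tmul, swap2_tmul, W_tmul, ← coactL_eq, ← coactR_eq, assoc_tmul]
  generalize X.coactL a2 = l
  have hr := X.q1_coactL c2
  generalize X.coactL c2 = r at hr ⊢
  subst hr
  revert l; refine pure_ind fun b3 a3 => ?_
  revert r; refine pure_ind fun b4 a4 => ?_
  simp [← TensorProduct.smul_tmul', smul_smul, mul_comm]

/-- The same product seen through `p₂ ⊗ p₁` gives the behaviour of `ν_l` on products. -/
theorem X_comodAlg2 : X.Sat (ax_comodAlg2 k B1 B2) := by
  unfold Sat ax_comodAlg2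
  refine TensorProduct.ext' fun a c => ?_
  have e := X.p2p1_D (X.m ((a ⊗ₜ[k] X.u2) ⊗ₜ[k] (c ⊗ₜ[k] X.u2)))
  rw [DM, D_i1, D_i1, m1x, ← coactL_eq] at e
  simp only [LinearMap.comp_apply, split2_tmul, skp2_assoc, skp_tmul]
  rw [← e]
  clear e
  have hs := X.l1_D a
  generalize X.d1.comul a = s at hs ⊢
  subst hs
  generalize X.d1.comul c = t
  revert s; refine pure_ind fun a1 a2 => ?_
  revert t; refine pure_ind fun c1 c2 => ?_
  simp only [split2_tmul, skp2_assoc, skp_tmul, merge2_tmul, swap2_tmul, W_tmul, ← coactL_eq, ← coactR_eq, assoc_tmul]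
  simp only [l1_tmul, map_smul, ← TensorProduct.smul_tmul']
  generalize X.coactL a2 = l
  revert l; refine pure_ind fun b3 a3 => ?_
  simp only [split2_tmul, skp2_assoc, skp_tmul, merge2_tmul, swap2_tmul, W_tmul, ← coactL_eq, ← coactR_eq, assoc_tmul]
  generalize X.coactL c2 = r
  revert r; refine pure_ind fun b4 a4 => ?_
  simp [← TensorProduct.smul_tmul', smul_smul, mul_comm]

/-- Coproduct of a product inside `B₂`. -/
theorem X_algCoalg2 : X.Sat (ax_algCoalg2 k B1 B2) := by
  unfold Sat ax_algCoalg2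
  refine TensorProduct.ext' fun a c => ?_
  have e := X.p2p2_D (X.m ((X.u1 ⊗ₜ[k] a) ⊗ₜ[k] (X.u1 ⊗ₜ[k] c)))
  rw [DM, D_i2, D_i2, mx2, p2_tmul, eu1, one_smul] at e
  simp only [LinearMap.comp_apply, split2_tmul, skp2_assoc, skp_tmul]
  rw [← e]
  clear e
  generalize X.d2.comul a = s
  generalize X.d2.comul c = t
  revert s; refine pure_ind fun a1 a2 => ?_
  revert t; refine pure_ind fun c1 c2 => ?_
  simp only [split2_tmul, skp2_assoc, skp_tmul, merge2_tmul, swap2_tmul, W_tmul, ← coactL_eq, ← coactR_eq, assoc_tmul]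
  have hl := X.q2_coactR a1
  generalize X.coactR a1 = l at hl ⊢
  subst hl
  generalize X.coactR c1 = r
  revert l; refine pure_ind fun b3 a3 => ?_
  revert r; refine pure_ind fun b4 a4 => ?_
  simp [← TensorProduct.smul_tmul', smul_smul, mul_comm]

/-- Behaviour of `ν_r` on products in `B₂`. -/
theorem X_comodAlg1 : X.Sat (ax_comodAlg1 k B1 B2) := by
  unfold Sat ax_comodAlg1
  refine TensorProduct.ext' fun a c => ?_
  have e := X.p2p1_D (X.m ((X.u1 ⊗ₜ[k] a) ⊗ₜ[k] (X.u1 ⊗ₜ[k] c)))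
  rw [DM, D_i2, D_i2, mx2, ← coactR_eq] at e
  simp only [LinearMap.comp_apply, split2_tmul, skp2_assoc, skp_tmul]
  rw [← e]
  clear e
  have ht := X.r2_D c
  generalize X.d2.comul c = t at ht ⊢
  subst ht
  generalize X.d2.comul a = s
  revert s; refine pure_ind fun a1 a2 => ?_
  revert t; refine pure_ind fun c1 c2 => ?_
  simp only [split2_tmul, skp2_assoc, skp_tmul, merge2_tmul, swap2_tmul, W_tmul, ← coactL_eq, ← coactR_eq, assoc_tmul]
  simp only [r2_tmul, map_smul, TensorProduct.tmul_smul]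
  generalize X.coactR a1 = l
  revert l; refine pure_ind fun b3 a3 => ?_
  simp only [split2_tmul, skp2_assoc, skp_tmul, merge2_tmul, swap2_tmul, W_tmul, ← coactL_eq, ← coactR_eq, assoc_tmul]
  generalize X.coactR c1 = r
  revert r; refine pure_ind fun b4 a4 => ?_
  simp [← TensorProduct.smul_tmul', smul_smul, mul_comm]

/-- Hexagon type identity for `φ₂₁` in its first argument, from associativity. -/
theorem phi21_mul2 (b c : B2) (a : B1) : X.phi21 (X.d2.mul (b ⊗ₜ[k] c) ⊗ₜ[k] a) = X.m ((X.u1 ⊗ₜ[k] b) ⊗ₜ[k] X.phi21 (c ⊗ₜ[k] a)) := by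
  rw [← m21, ← m21, ← AS, mx2]

/-- Hexagon type identity for `φ₂₁` in its second argument. -/
theorem phi21_mul1 (b : B2) (a c : B1) : X.phi21 (b ⊗ₜ[k] X.d1.mul (a ⊗ₜ[k] c)) = X.m (X.phi21 (b ⊗ₜ[k] a) ⊗ₜ[k] (c ⊗ₜ[k] X.u2)) := by
  rw [← m21, ← m21, AS, m1x]

theorem X_actL_act : X.Sat (ax_actL_act k B1 B2) := by
  unfold Sat ax_actL_act
  refine TensorProduct.ext_threefold' fun b c a => ?_
  simp only [LinearMap.comp_apply, merge2_tmul, skp_tmul]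
  rw [actL_eq, phi21_mul2, actL_eq X (c ⊗ₜ[k] a)]
  generalize X.phi21 (c ⊗ₜ[k] a) = t
  revert t; refine pure_ind fun a1 b1 => ?_
  simp [← TensorProduct.smul_tmul', smul_smul, mul_comm]

theorem X_actR_act : X.Sat (ax_actR_act k B1 B2) := by
  unfold Sat ax_actR_act
  refine TensorProduct.ext_threefold' fun b a c => ?_
  simp only [LinearMap.comp_apply, merge2_tmul, skp_tmul]
  rw [actR_eq, phi21_mul1, actR_eq X (b ⊗ₜ[k] a)]
  generalize X.phi21 (b ⊗ₜ[k] a) = t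
  revert t; refine pure_ind fun a1 b1 => ?_
  simp [← TensorProduct.smul_tmul', smul_smul, mul_comm]

theorem X_modAlg1 : X.Sat (ax_modAlg1 k B1 B2) := by
  unfold Sat ax_modAlg1
  refine TensorProduct.ext_threefold' fun b c a => ?_
  simp only [LinearMap.comp_apply, merge2_tmul, skp_tmul, split2_tmul, skp2_assoc]
  rw [actR_eq, phi21_mul2, ← phi21_mp, mpPhi21]
  simp only [LinearMap.comp_apply, split2_tmul, skp2_assoc]
  generalize X.d2.comul c = t
  generalize X.d1.comul a = s
  revert t; refine pure_ind fun c1 c2 => ?_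
  simp only [split2_tmul, skp2_assoc, skp_tmul, merge2_tmul, swap2_tmul, W_tmul, ← coactL_eq, ← coactR_eq, assoc_tmul]
  revert s; refine pure_ind fun a1 a2 => ?_
  simp [← TensorProduct.smul_tmul', smul_smul, mul_comm]

theorem X_modAlg2 : X.Sat (ax_modAlg2 k B1 B2) := by
  unfold Sat ax_modAlg2
  refine TensorProduct.ext_threefold' fun b a c => ?_
  simp only [LinearMap.comp_apply, merge2_tmul, skp_tmul, split2_tmul, skp2_assoc]
  rw [actL_eq, phi21_mul1, ← phi21_mp, mpPhi21]
  simp only [LinearMap.comp_apply, split2_tmul, skp2_assoc]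
  generalize X.d2.comul b = t
  generalize X.d1.comul a = s
  revert t; refine pure_ind fun c1 c2 => ?_
  simp only [split2_tmul, skp2_assoc, skp_tmul, merge2_tmul, swap2_tmul, W_tmul, ← coactL_eq, ← coactR_eq, assoc_tmul]
  revert s; refine pure_ind fun a1 a2 => ?_
  simp [← TensorProduct.smul_tmul', smul_smul, mul_comm]

/-- Coassociativity projected to `B₂ ⊗ B₂ ⊗ B₁`. -/
theorem CO221 (x : B1 ⊗[k] B2) : split2 X.d2.comul (X.phi12 x) = TensorProduct.map X.p2 X.phi12 (X.D x) := by
  have h := X.CO X.p2 X.p2 X.p1 x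
  have e1 : TensorProduct.map X.p2 X.p2 ∘ₗ X.D = X.d2.comul ∘ₗ X.p2 := LinearMap.ext X.p2p2_D
  have e2 : TensorProduct.map X.p2 X.p1 ∘ₗ X.D = X.phi12 := LinearMap.ext X.p2p1_D
  rw [e1, e2] at h
  rw [← h, ← p2p1_D]
  generalize X.D x = w
  revert w; refine pure_ind fun v1 v2 => ?_
  simp [split2_tmul, skp2_assoc]

/-- Coassociativity projected to `B₂ ⊗ B₁ ⊗ B₁`. -/
theorem CO211 (x : B1 ⊗[k] B2) : skp X.d1.comul (X.phi12 x) = TensorProduct.assoc k _ _ _ (TensorProduct.map X.phi12 X.p1 (X.D x)) := by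
  have h := X.CO X.p2 X.p1 X.p1 x
  have e1 : TensorProduct.map X.p1 X.p1 ∘ₗ X.D = X.d1.comul ∘ₗ X.p1 := LinearMap.ext X.p1p1_D
  have e2 : TensorProduct.map X.p2 X.p1 ∘ₗ X.D = X.phi12 := LinearMap.ext X.p2p1_D
  rw [e1, e2] at h
  rw [h, ← p2p1_D]
  generalize X.D x = w
  revert w; refine pure_ind fun v1 v2 => ?_
  simp [skp_tmul]

theorem X_coactL_coact : X.Sat (ax_coactL_coact k B1 B2) := by
  unfold Sat ax_coactL_coact
  refine LinearMap.ext fun a => ?_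
  simp only [LinearMap.comp_apply]
  rw [coactL_eq, CO221, D_i1, ← coactL_eq]
  have hs := X.l1_D a
  generalize X.d1.comul a = s at hs ⊢
  subst hs
  revert s; refine pure_ind fun a1 a2 => ?_
  simp only [split2_tmul, skp2_assoc, skp_tmul, merge2_tmul, swap2_tmul, W_tmul, ← coactL_eq, ← coactR_eq, assoc_tmul]
  simp only [l1_tmul, map_smul]
  generalize X.coactL a2 = l
  revert l; refine pure_ind fun b3 a3 => ?_
  simp [← TensorProduct.smul_tmul', smul_smul, mul_comm, ← coactL_eq, ← coactR_eq]

theorem X_coactR_coact : X.Sat (ax_coactR_coact k B1 B2) := by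
  unfold Sat ax_coactR_coact
  refine LinearMap.ext fun b => ?_
  simp only [LinearMap.comp_apply]
  symm
  rw [coactR_eq, CO211, D_i2, ← coactR_eq]
  have hs := X.r2_D b
  generalize X.d2.comul b = s at hs ⊢
  subst hs
  revert s; refine pure_ind fun a1 a2 => ?_
  simp only [split2_tmul, skp2_assoc, skp_tmul, merge2_tmul, swap2_tmul, W_tmul, ← coactL_eq, ← coactR_eq, assoc_tmul]
  simp only [r2_tmul, map_smul]
  generalize X.coactR a1 = l
  revert l; refine pure_ind fun b3 a3 => ?_
  simp [← TensorProduct.smul_tmul', smul_smul, mul_comm, ← coactL_eq, ← coactR_eq]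

theorem X_comodCoalg1 : X.Sat (ax_comodCoalg1 k B1 B2) := by
  unfold Sat ax_comodCoalg1
  refine LinearMap.ext fun b => ?_
  simp only [LinearMap.comp_apply]
  rw [coactR_eq, CO221, D_i2]
  generalize X.d2.comul b = s
  revert s; refine pure_ind fun b1 b2 => ?_
  simp only [W_tmul, ← coactR_eq, split2_tmul, skp2_assoc]
  generalize X.coactR b1 = l
  revert l; refine pure_ind fun b3 a3 => ?_
  simp only [Ins_tmul, TensorProduct.map_tmul, p2_tmul, eu1, one_smul, assoc_tmul, skp_tmul, ← phi12_mp, mpPhi12, LinearMap.comp_apply]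

/-- The last law needs an extra step: the inner coaction is first generalized in `key`, since it
sits to the right of the one that gets expanded by the reconstruction formula. -/
theorem X_comodCoalg2 : X.Sat (ax_comodCoalg2 k B1 B2) := by
  unfold Sat ax_comodCoalg2
  refine LinearMap.ext fun a => ?_
  simp only [LinearMap.comp_apply]
  rw [coactL_eq, CO211, D_i1]
  generalize X.d1.comul a = s
  revert s; refine pure_ind fun a1 a2 => ?_
  simp only [W_tmul, ← coactL_eq, split2_tmul]
  have key : ∀ r : B2 ⊗[k] B1, TensorProduct.assoc k B2 B1 B1 (TensorProduct.map X.phi12 X.p1 (Ins a1 X.u2 r)) = skp (merge2 X.d1.mul) (merge2 X.d2.mul (skp swap2 (skp (skp (split2 X.coactR)) (TensorProduct.assoc k _ _ _ (X.coactL a1 ⊗ₜ[k] r))))) := by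
    intro r
    revert r; refine pure_ind fun b5 a5 => ?_
    simp only [Ins_tmul, TensorProduct.map_tmul, p1_tmul, eu2, one_smul, ← phi12_mp, mpPhi12,
      LinearMap.comp_apply, split2_tmul, skp2_assoc]
    generalize X.coactL a1 = l
    revert l; refine pure_ind fun b3 a3 => ?_
    simp only [assoc_tmul, skp_tmul, split2_tmul, skp2_assoc]
    generalize X.coactR b5 = v
    revert v; refine pure_ind fun b4 a4 => ?_
    simp only [assoc_tmul, skp_tmul, swap2_tmul, merge2_tmul]
  rw [key]
  congr 4
  generalize X.coactL a1 = l
  revert l; refine pure_ind fun b3 a3 => ?_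
  simp only [assoc_tmul, skp_tmul]

/-! The remaining axioms only involve units and counits. -/

theorem X_actL_unit : X.Sat (ax_actL_unit k B1 B2) := by
  refine LinearMap.ext fun a => ?_
  simp [unit2, actL_u2]

theorem X_actR_unit : X.Sat (ax_actR_unit k B1 B2) := by
  refine LinearMap.ext fun a => ?_
  simp [unit1, actR_u1]

theorem X_coactL_counit : X.Sat (ax_coactL_counit k B1 B2) :=
  LinearMap.ext fun a => X.q1_coactL a

theorem X_coactR_counit : X.Sat (ax_coactR_counit k B1 B2) :=
  LinearMap.ext fun a => X.q2_coactR a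

theorem X_actR_eta2 : X.Sat (ax_actR_eta2 k B1 B2) := by
  refine LinearMap.ext fun a => ?_
  simp [unit2, actR_u2]

theorem X_coactL_eps1 : X.Sat (ax_coactL_eps1 k B1 B2) :=
  LinearMap.ext fun a => (X.q2_coactL a).trans (X.unit2 _).symm

theorem X_eps2_actR : X.Sat (ax_eps2_actR k B1 B2) := by
  refine TensorProduct.ext' fun b a => ?_
  simp [actR_eq, eps2_p2, counit_phi21]

theorem X_eps1_actL : X.Sat (ax_eps1_actL k B1 B2) := by
  refine TensorProduct.ext' fun b a => ?_
  simp [actL_eq, eps1_p1, counit_phi21]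

theorem X_actL_eta1 : X.Sat (ax_actL_eta1 k B1 B2) := by
  refine LinearMap.ext fun a => ?_
  simp [unit1, actL_u1]

theorem X_coactR_eps2 : X.Sat (ax_coactR_eps2 k B1 B2) :=
  LinearMap.ext fun a => (X.q1_coactR a).trans (X.unit1 _).symm

theorem X_coactR_eta2 : X.Sat (ax_coactR_eta2 k B1 B2) := by
  refine LinearMap.ext_ring ?_
  simp [unit1, unit2, coactR_eq, phi12_one]

theorem X_coactL_eta1 : X.Sat (ax_coactL_eta1 k B1 B2) := by
  refine LinearMap.ext_ring ?_
  simp [unit1, unit2, coactL_eq, phi12_one]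

end BAT

/-- Proposition 2.7: a bialgebra admissible tuple `(B₁, B₂, φ₁₂, φ₂₁)` yields a Hopf datum
via `μ_l = (id ⊗ ε₂) ∘ φ₂₁`, `μ_r = (ε₁ ⊗ id) ∘ φ₂₁`, `ν_l = φ₁₂ ∘ (id ⊗ η₂)`,
`ν_r = φ₁₂ ∘ (η₁ ⊗ id)`, and the structure maps reconstructed from this Hopf datum
recover `φ₁₂` and `φ₂₁`. -/
theorem bat_gives_hopfDatum
    {k : Type*} [CommRing k] {B1 B2 : Type*}
    [AddCommMonoid B1] [Module k B1] [AddCommMonoid B2] [Module k B2]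
    (d1 : ACData k B1) (d2 : ACData k B2)
    (h1 : d1.counit ∘ₗ d1.unit = LinearMap.id) (h2 : d2.counit ∘ₗ d2.unit = LinearMap.id)
    (phi12 : (B1 ⊗[k] B2) →ₗ[k] (B2 ⊗[k] B1)) (phi21 : (B2 ⊗[k] B1) →ₗ[k] (B1 ⊗[k] B2))
    (hb : IsBialgebraMaps k (B1 ⊗[k] B2)
      (crossMul d1.mul d2.mul phi21) (crossUnit d1.unit d2.unit)
      (crossComul d1.comul d2.comul phi12) (crossCounit d1.counit d2.counit)) :
    ∃ hd : HopfDatum k B1 B2,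
      hd.m1 = d1.mul ∧ hd.eta1 = d1.unit ∧ hd.delta1 = d1.comul ∧ hd.eps1 = d1.counit ∧
      hd.m2 = d2.mul ∧ hd.eta2 = d2.unit ∧ hd.delta2 = d2.comul ∧ hd.eps2 = d2.counit ∧
      hd.actL = (TensorProduct.rid k B1).toLinearMap ∘ₗ
        TensorProduct.map LinearMap.id d2.counit ∘ₗ phi21 ∧
      hd.actR = (TensorProduct.lid k B2).toLinearMap ∘ₗ
        TensorProduct.map d1.counit LinearMap.id ∘ₗ phi21 ∧
      hd.coactL = phi12 ∘ₗ TensorProduct.map LinearMap.id d2.unit ∘ₗ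
        (TensorProduct.rid k B1).symm.toLinearMap ∧
      hd.coactR = phi12 ∘ₗ TensorProduct.map d1.unit LinearMap.id ∘ₗ
        (TensorProduct.lid k B2).symm.toLinearMap ∧
      hdPhi12 hd = phi12 ∧ hdPhi21 hd = phi21 := by
  let X : BAT k B1 B2 := ⟨d1, d2, h1, h2, phi12, phi21, hb⟩
  refine ⟨{ m1 := d1.mul, eta1 := d1.unit, delta1 := d1.comul, eps1 := d1.counit,
            m2 := d2.mul, eta2 := d2.unit, delta2 := d2.comul, eps2 := d2.counit,
            actL := X.actL, coactL := X.coactL, actR := X.actR, coactR := X.coactR,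
            alg1 := d1.alg, coalg1 := d1.coalg, alg2 := d2.alg, coalg2 := d2.coalg,
            epseta1 := h1, epseta2 := h2,
            actL_act := X.X_actL_act,
            actL_unit := X.X_actL_unit,
            actR_act := X.X_actR_act,
            actR_unit := X.X_actR_unit,
            coactL_coact := X.X_coactL_coact,
            coactL_counit := X.X_coactL_counit,
            coactR_coact := X.X_coactR_coact,
            coactR_counit := X.X_coactR_counit,
            actR_eta2 := X.X_actR_eta2,
            coactL_eps1 := X.X_coactL_eps1,
            eps2_actR := X.X_eps2_actR,
            eps1_actL := X.X_eps1_actL,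
            actL_eta1 := X.X_actL_eta1,
            coactR_eps2 := X.X_coactR_eps2,
            coactR_eta2 := X.X_coactR_eta2,
            coactL_eta1 := X.X_coactL_eta1,
            algCoalg1 := X.X_algCoalg1,
            algCoalg2 := X.X_algCoalg2,
            modComod := X.X_modComod,
            modAlg1 := X.X_modAlg1,
            modAlg2 := X.X_modAlg2,
            comodCoalg1 := X.X_comodCoalg1,
            comodCoalg2 := X.X_comodCoalg2,
            modCoalg1 := X.X_modCoalg1,
            modCoalg2 := X.X_modCoalg2,
            comodAlg1 := X.X_comodAlg1,
            comodAlg2 := X.X_comodAlg2 },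
    rfl, rfl, rfl, rfl, rfl, rfl, rfl, rfl, rfl, rfl, rfl, rfl,
    TensorProduct.ext' X.phi12_mp, TensorProduct.ext' X.phi21_mp⟩

end CPB
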